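/- arXiv:1706.04569 — 3 statements merged into one kernel-verified Lean document; each statement's English description precedes it below -/
import Mathlib

section
/- Let d ∈ ℕ with d ≥ 1, n ∈ [2,3], and c ∈ [1.55, n), and set μ_c := sup A. Then μ_c ∈ [μ₃(Q₃), μ₂(Q₂)] (in particular μ_c < 0), and the solution Q of the IVP with μ = μ_c satisfies Q(r) > 0 and Q_r(r) < 0 for all r ∈ (0, ∞) (so that τ = ∞), and lim_{r→∞} Q(r) ≥ Q_*. -/
open Set Filter Topology intervalIntegral Real

noncomputable section

/-- The rescaled traveling-wave ODE for the magma equation at a point `r`. -/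
def magmaODE (d n c : ℝ) (Q : ℝ → ℝ) (r : ℝ) : Prop :=
  -deriv Q r + (1 / c) * deriv (fun s => Q s ^ n) r
    + deriv (fun s => Q s ^ n * deriv (deriv Q) s) r
    + (d - 1) * Q r ^ n * deriv (fun s => deriv Q s / s) r = 0

/-- Solution of the IVP on `[0, σ]`. -/
def isIVPSolutionOn (d n c μ : ℝ) (Q : ℝ → ℝ) (σ : ℝ) : Prop :=
  ContDiffOn ℝ 3 Q (Icc 0 σ) ∧ (∀ r ∈ Ioo (0:ℝ) σ, magmaODE d n c Q r) ∧
    Q 0 = 1 ∧ deriv Q 0 = 0 ∧ deriv (deriv Q) 0 = μ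

/-- Solution of the IVP on `[0, ∞)`. -/
def isIVPSolution (d n c μ : ℝ) (Q : ℝ → ℝ) : Prop :=
  ContDiffOn ℝ 3 Q (Ici 0) ∧ (∀ r : ℝ, 0 < r → magmaODE d n c Q r) ∧
    Q 0 = 1 ∧ deriv Q 0 = 0 ∧ deriv (deriv Q) 0 = μ

def F1 (d n c : ℝ) (Q μ : ℝ) : ℝ :=
  -(1 / (n - 1)) * (Q ^ (1 - n) - 1) - (n / c) * Real.log Q + μ * d

def F2 (d n c : ℝ) (Q μ : ℝ) : ℝ :=
  ∫ q in (1:ℝ)..Q, F1 d n c q μ * q ^ n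

def F3 (d n c : ℝ) (Q μ : ℝ) : ℝ :=
  F1 d n c Q μ - n * ∫ q in (1:ℝ)..Q, F2 d n c q μ * q ^ (-(n + 2))

def mu1 (d n c Q : ℝ) : ℝ := -(F1 d n c Q 0) / (F1 d n c Q 1 - F1 d n c Q 0)
def mu2 (d n c Q : ℝ) : ℝ := -(F2 d n c Q 0) / (F2 d n c Q 1 - F2 d n c Q 0)
def mu3 (d n c Q : ℝ) : ℝ := -(F3 d n c Q 0) / (F3 d n c Q 1 - F3 d n c Q 0)

def h3ex (d n Q : ℝ) : ℝ :=
  d * (1 - n * Real.log Q / (n + 1) - n / (n + 1) ^ 2 * (Q ^ (-(n + 1)) - 1))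

def setA (d n c Qs : ℝ) : Set ℝ :=
  {μ : ℝ | μ < 0 ∧ ∃ (Q : ℝ → ℝ) (σ rs : ℝ), 0 < rs ∧ rs < σ ∧
    isIVPSolutionOn d n c μ Q σ ∧ (∀ r ∈ Ioc (0:ℝ) σ, 0 < Q r ∧ deriv Q r < 0) ∧
    Q rs = Qs}

/-- The elementary estimate behind the weighted contraction. -/
theorem mul_exp_neg_le_one (x : ℝ) : x * exp (-x) ≤ 1 := by
  have h1 : x ≤ exp x := by linarith [add_one_le_exp x]
  calc x * exp (-x) ≤ exp x * exp (-x) := by gcongr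
    _ = 1 := by rw [← exp_add]; simp

theorem abs_mul_integral_exp_mul (a : ℝ) : a * ∫ t in (0:ℝ)..1, exp (a * t) = exp a - 1 := by
  rw [intervalIntegral.mul_integral_comp_mul_left (f := exp)]
  simp

/-- A Volterra equation `u r = x + r ∫₀¹ k t (u (r t)) dt` with a bounded kernel which is Lipschitz
in the state has a global solution, jointly continuous in the initial value and in `r`. -/
theorem exists_volterra_flow {E : Type*} [NormedAddCommGroup E] [NormedSpace ℝ E] [CompleteSpace E]
    (k : ℝ → E → E) (hk : Continuous (Function.uncurry k)) {L M : ℝ} (hL : 0 ≤ L)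
    (hlip : ∀ t ∈ Icc (0:ℝ) 1, ∀ x y, ‖k t x - k t y‖ ≤ L * ‖x - y‖)
    (hM : ∀ t ∈ Icc (0:ℝ) 1, ∀ x, ‖k t x‖ ≤ M) :
    ∃ Φ : E → ℝ → E, Continuous (Function.uncurry Φ) ∧
      ∀ x r, Φ x r = x + r • ∫ t in (0:ℝ)..1, k t (Φ x (r * t)) := by
  have hM0 : 0 ≤ M := (norm_nonneg _).trans (hM 0 ⟨le_rfl, zero_le_one⟩ 0)
  obtain ⟨l, hl1, hlL⟩ : ∃ l : ℝ, 1 ≤ l ∧ 2 * L ≤ l :=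
    ⟨max 1 (2 * L), le_max_left _ _, le_max_right _ _⟩
  have hl : 0 < l := by linarith
  let v : (BoundedContinuousFunction ℝ E) → ℝ → E := fun w r => exp (l * |r|) • w r
  have hv : ∀ w, Continuous (v w) := fun w => by fun_prop
  let I : (BoundedContinuousFunction ℝ E) → ℝ → E := fun w r =>
    ∫ t in (0:ℝ)..1, k t (v w (r * t))
  have hIu : ∀ w r, Continuous fun t => k t (v w (r * t)) := fun w r =>
    hk.comp (continuous_id.prodMk ((hv w).comp (continuous_const.mul continuous_id)))
  have hI : ∀ w, Continuous (I w) := fun w =>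
    continuous_parametric_intervalIntegral_of_continuous'
      (f := fun r t => k t (v w (r * t)))
      (hk.comp (continuous_snd.prodMk ((hv w).comp (continuous_fst.mul continuous_snd)))) _ _
  have hIb : ∀ w r, ‖I w r‖ ≤ M := fun w r => by
    have := norm_integral_le_of_norm_le_const (a := (0:ℝ)) (b := 1) (C := M)
      (f := fun t => k t (v w (r * t))) (fun t ht => by
        rw [uIoc_of_le zero_le_one] at ht
        exact hM t ⟨ht.1.le, ht.2⟩ _)
    simpa using this
  have hexp1 : ∀ r : ℝ, exp (-(l * |r|)) ≤ 1 := fun r => by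
    rw [exp_le_one_iff]; have := abs_nonneg r; nlinarith
  have hrexp : ∀ r : ℝ, exp (-(l * |r|)) * |r| ≤ 1 := fun r => by
    have h := mul_exp_neg_le_one (l * |r|)
    have h2 : 0 ≤ |r| * exp (-(l * |r|)) := by positivity
    nlinarith
  let T : E → (BoundedContinuousFunction ℝ E) → (BoundedContinuousFunction ℝ E) := fun x w =>
    BoundedContinuousFunction.ofNormedAddCommGroup
      (fun r => exp (-(l * |r|)) • (x + r • I w r))
      (by have := hI w; fun_prop) (‖x‖ + M) (fun r => by
        rw [norm_smul, norm_of_nonneg (exp_pos _).le]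
        calc exp (-(l * |r|)) * ‖x + r • I w r‖
            ≤ exp (-(l * |r|)) * (‖x‖ + |r| * M) := by
              gcongr
              refine (norm_add_le _ _).trans ?_
              rw [norm_smul, norm_eq_abs]
              gcongr
              exact hIb w r
          _ = exp (-(l * |r|)) * ‖x‖ + exp (-(l * |r|)) * |r| * M := by ring
          _ ≤ 1 * ‖x‖ + 1 * M := by
              gcongr
              · exact hexp1 r
              · exact hrexp r
          _ = _ := by ring)
  have hT : ∀ x w r, T x w r = exp (-(l * |r|)) • (x + r • I w r) := fun _ _ _ => rfl
  have hIdiff : ∀ w w' r, |r| * ‖I w r - I w' r‖ ≤ exp (l * |r|) * (1 / 2 * dist w w') := by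
    intro w w' r
    have h1 : ‖I w r - I w' r‖ ≤ ∫ t in (0:ℝ)..1, L * dist w w' * exp (l * |r| * t) := by
      simp only [I]
      rw [← intervalIntegral.integral_sub ((hIu w r).intervalIntegrable _ _)
        ((hIu w' r).intervalIntegrable _ _)]
      refine intervalIntegral.norm_integral_le_of_norm_le zero_le_one
        (Eventually.of_forall fun t ht => ?_) (Continuous.intervalIntegrable (by fun_prop) _ _)
      refine (hlip t ⟨ht.1.le, ht.2⟩ _ _).trans ?_
      simp only [v]
      rw [← smul_sub, norm_smul, norm_of_nonneg (exp_pos _).le, abs_mul, abs_of_pos ht.1,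
        ← dist_eq_norm]
      have := BoundedContinuousFunction.dist_coe_le_dist (f := w) (g := w') (r * t)
      calc L * (exp (l * (|r| * t)) * dist (w (r * t)) (w' (r * t)))
          ≤ L * (exp (l * (|r| * t)) * dist w w') := by gcongr
        _ = _ := by rw [← mul_assoc l]; ring
    rw [intervalIntegral.integral_const_mul] at h1
    have h2 := abs_mul_integral_exp_mul (l * |r|)
    have h3 : l * (|r| * ‖I w r - I w' r‖) ≤ L * dist w w' * (exp (l * |r|) - 1) := by
      rw [← h2]
      calc l * (|r| * ‖I w r - I w' r‖)
          ≤ l * (|r| * (L * dist w w' * ∫ t in (0:ℝ)..1, exp (l * |r| * t))) := by gcongr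
        _ = _ := by ring
    have h4 : 0 ≤ dist w w' := dist_nonneg
    have h5 : 1 ≤ exp (l * |r|) := one_le_exp (by positivity)
    have h6 : L * dist w w' * (exp (l * |r|) - 1) ≤ l / 2 * dist w w' * exp (l * |r|) := by
      gcongr
      · linarith
      · linarith
    refine le_of_mul_le_mul_left ?_ hl
    linarith
  have hcontr : ∀ x, ContractingWith (1/2) (T x) := fun x => by
    refine ⟨by rw [← NNReal.coe_lt_coe]; norm_num, LipschitzWith.of_dist_le_mul fun w w' => ?_⟩
    rw [BoundedContinuousFunction.dist_le (by positivity)]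
    intro r
    rw [hT, hT, dist_eq_norm, ← smul_sub, add_sub_add_left_eq_sub, ← smul_sub, norm_smul,
      norm_smul, norm_of_nonneg (exp_pos _).le, norm_eq_abs]
    calc exp (-(l * |r|)) * (|r| * ‖I w r - I w' r‖)
        ≤ exp (-(l * |r|)) * (exp (l * |r|) * (1 / 2 * dist w w')) :=
          mul_le_mul_of_nonneg_left (hIdiff w w' r) (exp_pos _).le
      _ = exp (-(l * |r|)) * exp (l * |r|) * (1 / 2 * dist w w') := by ring
      _ = _ := by rw [← exp_add]; simp
  let W : E → (BoundedContinuousFunction ℝ E) := fun x => ContractingWith.fixedPoint (T x) (hcontr x)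
  have hW : ∀ x, T x (W x) = W x := fun x => ContractingWith.fixedPoint_isFixedPt (hcontr x)
  have hWlip : LipschitzWith 2 W := LipschitzWith.of_dist_le_mul fun x y => by
    have := (hcontr x).dist_fixedPoint_fixedPoint_of_dist_le' (T y) (hW x) (hW y)
      (C := dist x y) (fun w => by
        rw [BoundedContinuousFunction.dist_le dist_nonneg]
        intro r
        rw [hT, hT, dist_eq_norm, ← smul_sub, add_sub_add_right_eq_sub, norm_smul,
          norm_of_nonneg (exp_pos _).le, dist_eq_norm]
        exact mul_le_of_le_one_left (norm_nonneg _) (hexp1 r))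
    refine this.trans (le_of_eq ?_)
    push_cast
    ring
  refine ⟨fun x => v (W x), ?_, fun x r => ?_⟩
  · have h1 : Continuous fun p : E × ℝ => W p.1 p.2 :=
      (hWlip.continuous.comp continuous_fst).eval continuous_snd
    change Continuous fun p : E × ℝ => exp (l * |p.2|) • W p.1 p.2
    fun_prop
  · have h1 : W x r = exp (-(l * |r|)) • (x + r • I (W x) r) := by
      rw [← hT, hW]
    change exp (l * |r|) • W x r = x + r • I (W x) r
    rw [h1, smul_smul, ← exp_add]
    simp

/-- A smooth function near a compact set coincides there with a compactly supported one. -/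
theorem exists_contDiff_hasCompactSupport_eq {E F : Type*} [NormedAddCommGroup E] [NormedSpace ℝ E]
    [FiniteDimensional ℝ E] [NormedAddCommGroup F] [NormedSpace ℝ F] {K U : Set E}
    (hK : IsCompact K) (hU : IsOpen U) (hKU : K ⊆ U) {g : E → F} (hg : ContDiffOn ℝ 2 g U) :
    ∃ f : E → F, ContDiff ℝ 2 f ∧ HasCompactSupport f ∧ ∀ x ∈ K, f x = g x := by
  have : ProperSpace E := FiniteDimensional.proper ℝ E
  obtain ⟨K', hK', hKK', hK'U⟩ := exists_compact_between hK hU hKU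
  obtain ⟨χ, h1, h0, -⟩ := exists_contMDiffMap_one_nhds_of_subset_interior (n := 2)
    (modelWithCornersSelf ℝ E) hK.isClosed hKK'
  have hχ : ContDiff ℝ 2 (χ : E → ℝ) := χ.contMDiff.contDiff
  have hsub : tsupport (fun x => χ x • g x) ⊆ K' := by
    refine closure_minimal (fun x hx => ?_) hK'.isClosed
    by_contra hx'
    exact hx (by simp [h0 x hx'])
  refine ⟨fun x => χ x • g x, contDiff_iff_contDiffAt.2 fun x => ?_,
    hK'.of_isClosed_subset (isClosed_tsupport _) hsub, fun x hx => ?_⟩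
  · by_cases hx : x ∈ tsupport (fun x => χ x • g x)
    · exact hχ.contDiffAt.smul (hg.contDiffAt (hU.mem_nhds (hK'U (hsub hx))))
    · have : (fun x => χ x • g x) =ᶠ[𝓝 x] fun _ => 0 := by
        rwa [notMem_tsupport_iff_eventuallyEq] at hx
      exact contDiffAt_const.congr_of_eventuallyEq this
  · simp [h1.self_of_nhdsSet x hx]

/-- The weighted mean `∫₀¹ tᵐ g (r t) dt` of `g` over `[0, r]`. -/
def radialMean (m : ℕ) (g : ℝ → ℝ) (r : ℝ) : ℝ := ∫ t in (0:ℝ)..1, t ^ m * g (r * t)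

theorem continuous_radialMean_uncurry {X : Type*} [TopologicalSpace X] (m : ℕ) {g : X → ℝ → ℝ}
    (hg : Continuous (Function.uncurry g)) :
    Continuous fun p : X × ℝ => radialMean m (g p.1) p.2 :=
  continuous_parametric_intervalIntegral_of_continuous'
    (f := fun (p : X × ℝ) t => t ^ m * g p.1 (p.2 * t))
    ((continuous_snd.pow m).mul (hg.comp ((continuous_fst.comp continuous_fst).prodMk
      ((continuous_snd.comp continuous_fst).mul continuous_snd)))) _ _

theorem continuous_radialMean (m : ℕ) {g : ℝ → ℝ} (hg : Continuous g) :
    Continuous (radialMean m g) :=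
  (continuous_radialMean_uncurry m (g := fun _ : Unit => g) (hg.comp continuous_snd)).comp
    (continuous_const (y := ()) |>.prodMk continuous_id)

theorem radialMean_zero (m : ℕ) (g : ℝ → ℝ) : radialMean m g 0 = g 0 / (m + 1) := by
  simp [radialMean]
  ring

theorem pow_mul_radialMean (m : ℕ) (g : ℝ → ℝ) (r : ℝ) :
    r ^ (m + 1) * radialMean m g r = ∫ s in (0:ℝ)..r, s ^ m * g s := by
  have h := intervalIntegral.mul_integral_comp_mul_left (a := 0) (b := 1)
    (f := fun s => s ^ m * g s) r
  rw [mul_zero, mul_one] at h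
  rw [← h, pow_succ', mul_assoc, radialMean, ← intervalIntegral.integral_const_mul]
  congr 1
  refine intervalIntegral.integral_congr fun t _ => ?_
  simp only [mul_pow]
  ring

theorem hasDerivAt_mul_radialMean (m : ℕ) {g : ℝ → ℝ} (hg : Continuous g) (r : ℝ) :
    HasDerivAt (fun r => r * radialMean m g r) (g r - m * radialMean m g r) r := by
  rcases eq_or_ne r 0 with rfl | hr
  · have h0 : g 0 - m * radialMean m g 0 = radialMean m g 0 := by
      rw [radialMean_zero]
      field_simp
      ring
    rw [h0, hasDerivAt_iff_tendsto_slope]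
    refine (((continuous_radialMean m hg).tendsto 0).mono_left nhdsWithin_le_nhds).congr' ?_
    filter_upwards [self_mem_nhdsWithin] with s hs
    have hs : s ≠ 0 := hs
    simp [slope_def_field, hs]
  · have hint : HasDerivAt (fun r => ∫ s in (0:ℝ)..r, s ^ m * g s) (r ^ m * g r) r :=
      (((continuous_id.pow m).mul hg).integral_hasStrictDerivAt 0 r).hasDerivAt
    have hdiv := hint.div (hasDerivAt_pow m r) (pow_ne_zero m hr)
    refine (hdiv.congr_of_eventuallyEq ?_).congr_deriv ?_
    · filter_upwards [isOpen_ne.mem_nhds hr] with s hs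
      have hs : s ≠ 0 := hs
      simp only [Pi.div_apply]
      rw [← pow_mul_radialMean, eq_div_iff (pow_ne_zero m hs)]
      ring
    · rw [← pow_mul_radialMean]
      rcases m with _ | m
      · simp
      · simp only [Nat.add_sub_cancel]
        field_simp
        ring

theorem contDiff_radialMean (m : ℕ) {g : ℝ → ℝ} (hg : ContDiff ℝ 1 g) :
    ContDiff ℝ 1 (radialMean m g) := by
  have hg' : Continuous (deriv g) := hg.continuous_deriv le_rfl
  have key : ∀ r, HasDerivAt (radialMean m g) (radialMean (m + 1) (deriv g) r) r := by
    intro r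
    obtain ⟨C, hC⟩ := (isCompact_Icc (a := -(|r| + 1)) (b := |r| + 1)).exists_bound_of_continuousOn
      hg'.continuousOn
    have hcont : ∀ s, Continuous fun t => t ^ m * g (s * t) := fun s => by
      have := hg.continuous; fun_prop
    have hcont' : Continuous fun t => t ^ (m + 1) * deriv g (r * t) := by fun_prop
    refine (intervalIntegral.hasDerivAt_integral_of_dominated_loc_of_deriv_le
      (F := fun s t => t ^ m * g (s * t)) (F' := fun s t => t ^ (m + 1) * deriv g (s * t))
      (bound := fun _ => C) (Metric.ball_mem_nhds r one_pos)
      (Eventually.of_forall fun s => (hcont s).aestronglyMeasurable)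
      ((hcont r).intervalIntegrable _ _) hcont'.aestronglyMeasurable
      (Eventually.of_forall fun t ht s hs => ?_) (by simp)
      (Eventually.of_forall fun t ht s hs => ?_)).2
    · rw [uIoc_of_le zero_le_one] at ht
      have hs' : |s| ≤ |r| + 1 := by
        rw [Metric.mem_ball, dist_eq] at hs
        have := abs_sub_abs_le_abs_sub s r
        linarith
      have hst : |s * t| ≤ |r| + 1 := by
        rw [abs_mul, abs_of_pos ht.1]
        exact (mul_le_of_le_one_right (abs_nonneg _) ht.2).trans hs'
      rw [norm_mul, norm_pow, norm_of_nonneg ht.1.le]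
      exact (mul_le_of_le_one_left (norm_nonneg _) (pow_le_one₀ ht.1.le ht.2)).trans
        (hC _ (abs_le.1 hst))
    · have h1 := (hg.differentiable one_ne_zero (s * t)).hasDerivAt.comp s
        ((hasDerivAt_id s).mul_const t)
      refine (h1.const_mul (t ^ m)).congr_deriv ?_
      simp only [one_mul]
      ring
  rw [contDiff_one_iff_deriv]
  refine ⟨fun r => (key r).differentiableAt, ?_⟩
  rw [funext fun r => (key r).deriv]
  exact continuous_radialMean _ hg'

/-- `Φ` is the flow of the radial system `Q' = f₁`, `(rᵐ P)' = rᵐ f₂`, `W' = f₃`. -/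
structure IsRadialFlow (m : ℕ) (f : ℝ × ℝ × ℝ → ℝ × ℝ × ℝ) (Φ : ℝ × ℝ × ℝ → ℝ → ℝ × ℝ × ℝ) :
    Prop where
  continuous : Continuous (Function.uncurry Φ)
  initial : ∀ x, Φ x 0 = x
  hasDerivAt_fst : ∀ x r, HasDerivAt (fun s => (Φ x s).1) (f (Φ x r)).1 r
  snd_eq : ∀ x r, (Φ x r).2.1 = x.2.1 + r * radialMean m (fun s => (f (Φ x s)).2.1) r
  hasDerivAt_thd : ∀ x r, HasDerivAt (fun s => (Φ x s).2.2) (f (Φ x r)).2.2 r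

theorem exists_isRadialFlow (m : ℕ) {f : ℝ × ℝ × ℝ → ℝ × ℝ × ℝ} (hf : ContDiff ℝ 2 f)
    (hsupp : HasCompactSupport f) : ∃ Φ, IsRadialFlow m f Φ := by
  obtain ⟨L, hL⟩ := hf.lipschitzWith_of_hasCompactSupport hsupp two_ne_zero
  obtain ⟨M, hM⟩ := hsupp.exists_bound_of_continuous hf.continuous
  have hfc := hf.continuous
  have hpow : ∀ t ∈ Icc (0:ℝ) 1, |t ^ m| ≤ 1 := fun t ht => by
    rw [abs_of_nonneg (pow_nonneg ht.1 m)]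
    exact pow_le_one₀ ht.1 ht.2
  have hscale : ∀ t ∈ Icc (0:ℝ) 1, ∀ a : ℝ × ℝ × ℝ, ‖(a.1, t ^ m * a.2.1, a.2.2)‖ ≤ ‖a‖ := by
    intro t ht a
    simp only [Prod.norm_def]
    refine max_le_max le_rfl (max_le_max ?_ le_rfl)
    rw [norm_mul]
    exact mul_le_of_le_one_left (norm_nonneg _) (hpow t ht)
  let k : ℝ → ℝ × ℝ × ℝ → ℝ × ℝ × ℝ := fun t x => ((f x).1, t ^ m * (f x).2.1, (f x).2.2)
  have hk : Continuous (Function.uncurry k) := by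
    change Continuous fun p : ℝ × ℝ × ℝ × ℝ => ((f p.2).1, p.1 ^ m * (f p.2).2.1, (f p.2).2.2)
    fun_prop
  obtain ⟨Φ, hΦ, heq⟩ := exists_volterra_flow k hk (L := L) (M := M) L.2
    (fun t ht x y => by
      have h1 : k t x - k t y = ((f x - f y).1, t ^ m * (f x - f y).2.1, (f x - f y).2.2) := by
        simp [k, mul_sub]
      rw [h1]
      exact (hscale t ht _).trans (hL.norm_sub_le x y))
    (fun t ht x => (hscale t ht _).trans (hM x))
  have hΦx : ∀ x, Continuous (Φ x) := fun x => hΦ.comp (continuous_const.prodMk continuous_id)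
  have hint : ∀ x r, IntervalIntegrable (fun t => k t (Φ x (r * t))) MeasureTheory.volume 0 1 :=
    fun x r => (hk.comp (continuous_id.prodMk ((hΦx x).comp
      (continuous_const.mul continuous_id)))).intervalIntegrable _ _
  have hfst : ∀ x r, (Φ x r).1 = x.1 + r * radialMean 0 (fun s => (f (Φ x s)).1) r := by
    intro x r
    have h := (ContinuousLinearMap.fst ℝ ℝ (ℝ × ℝ)).intervalIntegral_comp_comm (hint x r)
    rw [heq x r, Prod.fst_add, Prod.smul_fst, smul_eq_mul]
    simp only [ContinuousLinearMap.coe_fst'] at h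
    rw [← h]
    simp [radialMean, k]
  have hsnd : ∀ x r, (Φ x r).2.1 = x.2.1 + r * radialMean m (fun s => (f (Φ x s)).2.1) r := by
    intro x r
    have h := ((ContinuousLinearMap.fst ℝ ℝ ℝ).comp
      (ContinuousLinearMap.snd ℝ ℝ (ℝ × ℝ))).intervalIntegral_comp_comm (hint x r)
    rw [heq x r, Prod.snd_add, Prod.smul_snd, Prod.fst_add, Prod.smul_fst, smul_eq_mul]
    simp only [ContinuousLinearMap.comp_apply, ContinuousLinearMap.coe_fst',
      ContinuousLinearMap.coe_snd'] at h
    rw [← h]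
    rfl
  have hthd : ∀ x r, (Φ x r).2.2 = x.2.2 + r * radialMean 0 (fun s => (f (Φ x s)).2.2) r := by
    intro x r
    have h := ((ContinuousLinearMap.snd ℝ ℝ ℝ).comp
      (ContinuousLinearMap.snd ℝ ℝ (ℝ × ℝ))).intervalIntegral_comp_comm (hint x r)
    rw [heq x r, Prod.snd_add, Prod.smul_snd, Prod.snd_add, Prod.smul_snd, smul_eq_mul]
    simp only [ContinuousLinearMap.comp_apply, ContinuousLinearMap.coe_snd'] at h
    rw [← h]
    simp [radialMean, k]
  refine ⟨Φ, hΦ, fun x => by rw [heq]; simp, fun x r => ?_, hsnd, fun x r => ?_⟩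
  · rw [funext (hfst x)]
    have hc := hΦx x
    refine ((hasDerivAt_mul_radialMean 0 (g := fun s => (f (Φ x s)).1)
      (by fun_prop) r).const_add x.1).congr_deriv (by simp)
  · rw [funext (hthd x)]
    have hc := hΦx x
    refine ((hasDerivAt_mul_radialMean 0 (g := fun s => (f (Φ x s)).2.2)
      (by fun_prop) r).const_add x.2.2).congr_deriv (by simp)

namespace IsRadialFlow

variable {m : ℕ} {f : ℝ × ℝ × ℝ → ℝ × ℝ × ℝ} {Φ : ℝ × ℝ × ℝ → ℝ → ℝ × ℝ × ℝ}

theorem continuous_apply (h : IsRadialFlow m f Φ) (x : ℝ × ℝ × ℝ) : Continuous (Φ x) :=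
  h.continuous.comp (continuous_const.prodMk continuous_id)

theorem hasDerivAt_snd (h : IsRadialFlow m f Φ) (hf : Continuous f) (x : ℝ × ℝ × ℝ) (r : ℝ) :
    HasDerivAt (fun s => (Φ x s).2.1)
      ((f (Φ x r)).2.1 - m * radialMean m (fun s => (f (Φ x s)).2.1) r) r := by
  rw [funext (h.snd_eq x)]
  have hc := h.continuous_apply x
  exact (hasDerivAt_mul_radialMean m (g := fun s => (f (Φ x s)).2.1) (by fun_prop) r).const_add _

theorem contDiff_fst (h : IsRadialFlow m f Φ) (hf : ContDiff ℝ 2 f) (x : ℝ × ℝ × ℝ) :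
    ContDiff ℝ 3 (fun r => (Φ x r).1) := by
  have hfc := hf.continuous
  have hc := h.continuous_apply x
  have h1 : ContDiff ℝ 1 (Φ x) := by
    have e1 : ContDiff ℝ 1 (fun r => (Φ x r).1) := contDiff_one_iff_deriv.2
      ⟨fun r => (h.hasDerivAt_fst x r).differentiableAt, by
        rw [funext fun r => (h.hasDerivAt_fst x r).deriv]; fun_prop⟩
    have e2 : ContDiff ℝ 1 (fun r => (Φ x r).2.1) := contDiff_one_iff_deriv.2
      ⟨fun r => (h.hasDerivAt_snd hfc x r).differentiableAt, by
        rw [funext fun r => (h.hasDerivAt_snd hfc x r).deriv]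
        have := continuous_radialMean m (g := fun s => (f (Φ x s)).2.1) (by fun_prop)
        fun_prop⟩
    have e3 : ContDiff ℝ 1 (fun r => (Φ x r).2.2) := contDiff_one_iff_deriv.2
      ⟨fun r => (h.hasDerivAt_thd x r).differentiableAt, by
        rw [funext fun r => (h.hasDerivAt_thd x r).deriv]; fun_prop⟩
    exact e1.prodMk (e2.prodMk e3)
  have hsucc : ∀ {u u' : ℝ → ℝ} (N : ℕ), (∀ r, HasDerivAt u (u' r) r) → ContDiff ℝ N u' →
      ContDiff ℝ (N + 1) u := fun {u u'} N hu hu' => by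
    rw [contDiff_succ_iff_deriv]
    refine ⟨fun r => (hu r).differentiableAt, by simp, ?_⟩
    rwa [funext fun r => (hu r).deriv]
  have hf1 : ContDiff ℝ 1 f := hf.of_le one_le_two
  have hfu : ContDiff ℝ 1 fun r => f (Φ x r) := hf1.comp h1
  have h2 : ContDiff ℝ 2 (Φ x) := by
    have e1 := hsucc 1 (h.hasDerivAt_fst x) (by exact_mod_cast hfu.fst)
    have e2 := hsucc 1 (h.hasDerivAt_snd hfc x) (by
      have := contDiff_radialMean m hfu.snd.fst
      exact_mod_cast hfu.snd.fst.sub (contDiff_const.mul this))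
    have e3 := hsucc 1 (h.hasDerivAt_thd x) (by exact_mod_cast hfu.snd.snd)
    have e := e1.prodMk (e2.prodMk e3)
    norm_num at e
    exact e
  have h3 := hsucc 2 (h.hasDerivAt_fst x) (by exact_mod_cast (hf.comp h2).fst)
  norm_num at h3
  exact h3

end IsRadialFlow

section Potentials

variable {d n c : ℝ}

theorem F1_eq (q μ : ℝ) : F1 d n c q μ = F1 d n c q 0 + μ * d := by
  simp [F1]

theorem hasDerivAt_F1 (hn : n ≠ 1) (μ : ℝ) {q : ℝ} (hq : 0 < q) :
    HasDerivAt (fun q => F1 d n c q μ) (q ^ (-n) - n / c / q) q := by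
  have h1 := (hasDerivAt_rpow_const (p := 1 - n) (Or.inl hq.ne'))
  have h2 := Real.hasDerivAt_log hq.ne'
  have h := ((((h1.sub_const 1).const_mul (-(1 / (n - 1)))).sub (h2.const_mul (n / c))).add_const
    (μ * d))
  refine h.congr_deriv ?_
  have hn' : n - 1 ≠ 0 := sub_ne_zero.2 hn
  rw [show 1 - n - 1 = -n by ring]
  field_simp
  ring

theorem continuousOn_F1 (hn : n ≠ 1) (μ : ℝ) : ContinuousOn (fun q => F1 d n c q μ) (Ioi 0) :=
  fun _ hq => (hasDerivAt_F1 hn μ hq).continuousAt.continuousWithinAt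

theorem hasDerivAt_integral_of_continuousOn_Ioi {u : ℝ → ℝ} (hu : ContinuousOn u (Ioi 0)) {q : ℝ}
    (hq : 0 < q) : HasDerivAt (fun q => ∫ s in (1:ℝ)..q, u s) (u q) q := by
  have hsub : uIcc 1 q ⊆ Ioi 0 := fun s hs => (lt_min one_pos hq).trans_le hs.1
  exact integral_hasDerivAt_right (hu.mono hsub).intervalIntegrable
    (hu.stronglyMeasurableAtFilter isOpen_Ioi q hq) (hu.continuousAt (Ioi_mem_nhds hq))

theorem continuousOn_rpow_const_Ioi (p : ℝ) : ContinuousOn (fun q : ℝ => q ^ p) (Ioi 0) :=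
  fun _ hq => (continuousAt_rpow_const _ _ (Or.inl (ne_of_gt hq))).continuousWithinAt

theorem hasDerivAt_F2 (hn : n ≠ 1) (μ : ℝ) {q : ℝ} (hq : 0 < q) :
    HasDerivAt (fun q => F2 d n c q μ) (F1 d n c q μ * q ^ n) q :=
  hasDerivAt_integral_of_continuousOn_Ioi
    ((continuousOn_F1 hn μ).mul (continuousOn_rpow_const_Ioi n)) hq

theorem continuousOn_F2 (hn : n ≠ 1) (μ : ℝ) : ContinuousOn (fun q => F2 d n c q μ) (Ioi 0) :=
  fun _ hq => (hasDerivAt_F2 hn μ hq).continuousAt.continuousWithinAt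

theorem F2_one (μ : ℝ) : F2 d n c 1 μ = 0 := by simp [F2]

theorem hasDerivAt_F3_sub_F1 (hn : n ≠ 1) (μ : ℝ) {q : ℝ} (hq : 0 < q) :
    HasDerivAt (fun q => F3 d n c q μ - F1 d n c q μ)
      (-(n * (F2 d n c q μ * q ^ (-(n + 2))))) q := by
  have h := ((hasDerivAt_integral_of_continuousOn_Ioi
    ((continuousOn_F2 (d := d) (c := c) hn μ).mul
      (continuousOn_rpow_const_Ioi (-(n + 2)))) hq).const_mul n).neg
  have h0 : (fun q => F3 d n c q μ - F1 d n c q μ) =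
      -fun q => n * ∫ s in (1:ℝ)..q, F2 d n c s μ * s ^ (-(n + 2)) := by
    funext q
    simp [F3]
  rw [h0]
  exact h

theorem F1_one (μ : ℝ) : F1 d n c 1 μ = μ * d := by simp [F1]

theorem F3_one (μ : ℝ) : F3 d n c 1 μ = μ * d := by simp [F3, F1_one]

theorem hasDerivAt_F3 (hn : n ≠ 1) (μ : ℝ) {q : ℝ} (hq : 0 < q) :
    HasDerivAt (fun q => F3 d n c q μ)
      (-(n * (F2 d n c q μ * q ^ (-(n + 2)))) + (q ^ (-n) - n / c / q)) q := by
  have h := (hasDerivAt_F3_sub_F1 (d := d) (c := c) hn μ hq).add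
    (hasDerivAt_F1 (d := d) (c := c) hn μ hq)
  have h0 : (fun q => F3 d n c q μ) =
      (fun q => F3 d n c q μ - F1 d n c q μ) + fun q => F1 d n c q μ := by
    funext q
    simp
  rw [h0]
  exact h

theorem continuousOn_F3 (hn : n ≠ 1) (μ : ℝ) : ContinuousOn (fun q => F3 d n c q μ) (Ioi 0) :=
  fun _ hq => (hasDerivAt_F3 hn μ hq).continuousAt.continuousWithinAt

theorem F2_affine (hn : n ≠ 1) (μ : ℝ) {q : ℝ} (hq : 0 < q) :
    F2 d n c q μ = F2 d n c q 0 + μ * (F2 d n c q 1 - F2 d n c q 0) := by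
  have hint : ∀ μ, IntervalIntegrable (fun s => F1 d n c s μ * s ^ n) MeasureTheory.volume 1 q :=
    fun μ => (((continuousOn_F1 hn μ).mul (continuousOn_rpow_const_Ioi n)).mono
      fun s hs => (lt_min one_pos hq).trans_le hs.1).intervalIntegrable
  simp only [F2]
  rw [← integral_sub (hint 1) (hint 0), ← intervalIntegral.integral_const_mul,
    ← integral_add (hint 0) (((hint 1).sub (hint 0)).const_mul μ)]
  refine integral_congr fun s _ => ?_
  simp only [F1_eq s μ, F1_eq s 1]
  ring

theorem F3_affine (hn : n ≠ 1) (μ : ℝ) {q : ℝ} (hq : 0 < q) :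
    F3 d n c q μ = F3 d n c q 0 + μ * (F3 d n c q 1 - F3 d n c q 0) := by
  have hsub : uIcc 1 q ⊆ Ioi 0 := fun s hs => (lt_min one_pos hq).trans_le hs.1
  have hint : ∀ μ, IntervalIntegrable (fun s => F2 d n c s μ * s ^ (-(n + 2)))
      MeasureTheory.volume 1 q :=
    fun μ => (((continuousOn_F2 hn μ).mul (continuousOn_rpow_const_Ioi (-(n + 2)))).mono
      hsub).intervalIntegrable
  have h : (∫ s in (1:ℝ)..q, F2 d n c s μ * s ^ (-(n + 2))) =
      (∫ s in (1:ℝ)..q, F2 d n c s 0 * s ^ (-(n + 2))) +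
      μ * ((∫ s in (1:ℝ)..q, F2 d n c s 1 * s ^ (-(n + 2))) -
        ∫ s in (1:ℝ)..q, F2 d n c s 0 * s ^ (-(n + 2))) := by
    rw [← integral_sub (hint 1) (hint 0), ← intervalIntegral.integral_const_mul,
      ← integral_add (hint 0) (((hint 1).sub (hint 0)).const_mul μ)]
    refine integral_congr fun s hs => ?_
    simp only [F2_affine hn μ (hsub hs)]
    ring
  simp only [F3]
  rw [h, F1_eq q μ, F1_eq q 1]
  ring

theorem F2_slope_neg (hn : n ≠ 1) (hd : 0 < d) {q : ℝ} (hq : 0 < q) (hq1 : q < 1) :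
    F2 d n c q 1 - F2 d n c q 0 < 0 := by
  have hanti : StrictMonoOn (fun q => F2 d n c q 1 - F2 d n c q 0) (Ioi 0) := by
    refine strictMonoOn_of_deriv_pos (convex_Ioi 0)
      ((continuousOn_F2 hn 1).sub (continuousOn_F2 hn 0)) fun s hs => ?_
    rw [interior_Ioi] at hs
    have hderiv : HasDerivAt (fun q => F2 d n c q 1 - F2 d n c q 0) _ s :=
      (hasDerivAt_F2 hn 1 hs).sub (hasDerivAt_F2 hn 0 hs)
    rw [hderiv.deriv, F1_eq s 1]
    have := rpow_pos_of_pos hs n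
    nlinarith [mul_pos hd this]
  have := hanti (mem_Ioi.2 hq) (mem_Ioi.2 one_pos) hq1
  simpa [F2_one] using this

end Potentials

/-- The right-hand side of the radial system equivalent to the magma equation: with
`P = Q_r` and `W` the sum of `μ d` and the memory term, `Q_rr + (d-1) Q_r / r` is
`radialForce n c Q P W`. -/
def radialForce (n c q p w : ℝ) : ℝ := F1 0 n c q 0 - n * p ^ 2 / (2 * q) + w

/-- The radial system on `[0, σ]`, in dimension `m + 1`. -/
structure IsRadialSolution (m : ℕ) (n c μ σ : ℝ) (Q P W : ℝ → ℝ) : Prop where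
  continuousOn_fst : ContinuousOn Q (Icc 0 σ)
  continuousOn_snd : ContinuousOn P (Icc 0 σ)
  continuousOn_thd : ContinuousOn W (Icc 0 σ)
  fst_zero : Q 0 = 1
  snd_zero : P 0 = 0
  thd_zero : W 0 = μ * (m + 1)
  pos : ∀ r ∈ Icc 0 σ, 0 < Q r
  hasDerivAt_fst : ∀ r ∈ Ioo 0 σ, HasDerivAt Q (P r) r
  hasDerivAt_snd : ∀ r ∈ Ioo 0 σ,
    HasDerivAt P (radialForce n c (Q r) (P r) (W r) - m * (P r / r)) r
  hasDerivAt_thd : ∀ r ∈ Ioo 0 σ, HasDerivAt W (-(n * P r ^ 3 / (2 * Q r ^ 2))) r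

namespace IsRadialSolution

variable {m : ℕ} {n c μ σ : ℝ} {Q P W : ℝ → ℝ}

theorem mono (h : IsRadialSolution m n c μ σ Q P W) {τ : ℝ} (hτ : τ ≤ σ) :
    IsRadialSolution m n c μ τ Q P W where
  continuousOn_fst := h.continuousOn_fst.mono (Icc_subset_Icc_right hτ)
  continuousOn_snd := h.continuousOn_snd.mono (Icc_subset_Icc_right hτ)
  continuousOn_thd := h.continuousOn_thd.mono (Icc_subset_Icc_right hτ)
  fst_zero := h.fst_zero
  snd_zero := h.snd_zero
  thd_zero := h.thd_zero
  pos r hr := h.pos r (Icc_subset_Icc_right hτ hr)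
  hasDerivAt_fst r hr := h.hasDerivAt_fst r (Ioo_subset_Ioo_right hτ hr)
  hasDerivAt_snd r hr := h.hasDerivAt_snd r (Ioo_subset_Ioo_right hτ hr)
  hasDerivAt_thd r hr := h.hasDerivAt_thd r (Ioo_subset_Ioo_right hτ hr)

theorem pos_of_deriv_pos {u u' : ℝ → ℝ} (hu : ContinuousOn u (Icc 0 σ)) (h0 : u 0 = 0)
    (hu' : ∀ r ∈ Ioo 0 σ, HasDerivAt u (u' r) r) (hpos : ∀ r ∈ Ioo 0 σ, 0 < u' r) :
    ∀ r ∈ Ioc 0 σ, 0 < u r := by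
  have hmono : StrictMonoOn u (Icc 0 σ) := by
    refine strictMonoOn_of_deriv_pos (convex_Icc 0 σ) hu fun r hr => ?_
    rw [interior_Icc] at hr
    rw [(hu' r hr).deriv]
    exact hpos r hr
  intro r hr
  have := hmono (left_mem_Icc.2 (hr.1.le.trans hr.2)) ⟨hr.1.le, hr.2⟩ hr.1
  rwa [h0] at this

theorem fst_lt_one (h : IsRadialSolution m n c μ σ Q P W) (hP : ∀ r ∈ Ioo 0 σ, P r < 0) :
    ∀ r ∈ Ioc 0 σ, Q r < 1 := by
  intro r hr
  have := pos_of_deriv_pos (u := fun r => 1 - Q r) (u' := fun r => -P r)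
    (continuousOn_const.sub h.continuousOn_fst) (by simp [h.fst_zero])
    (fun r hr => (h.hasDerivAt_fst r hr).const_sub 1) (fun r hr => neg_pos.2 (hP r hr)) r hr
  linarith

theorem lt_thd (h : IsRadialSolution m n c μ σ Q P W) (hn : 0 < n)
    (hP : ∀ r ∈ Ioo 0 σ, P r < 0) : ∀ r ∈ Ioc 0 σ, μ * (m + 1) < W r := by
  intro r hr
  have := pos_of_deriv_pos (u := fun r => W r - μ * (m + 1))
    (h.continuousOn_thd.sub continuousOn_const) (by simp [h.thd_zero])
    (fun r hr => (h.hasDerivAt_thd r hr).sub_const _) (fun r hr => by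
      have h1 := h.pos r (Ioo_subset_Icc_self hr)
      have h2 : 0 < (-P r) ^ 3 := pow_pos (neg_pos.2 (hP r hr)) 3
      have h3 : -(n * P r ^ 3 / (2 * Q r ^ 2)) = n * (-P r) ^ 3 / (2 * Q r ^ 2) := by ring
      rw [h3]
      positivity) r hr
  linarith

variable {d : ℝ}

/-- The first energy estimate. -/
theorem rpow_mul_sq_lt_F2 (h : IsRadialSolution m n c μ σ Q P W) (hn : 1 < n) (hd : d = m + 1)
    (hP : ∀ r ∈ Ioo 0 σ, P r < 0) :
    ∀ r ∈ Ioc 0 σ, Q r ^ n * P r ^ 2 / 2 < F2 d n c (Q r) μ := by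
  intro r hr
  have hcQ : ContinuousOn (fun r => F2 d n c (Q r) μ) (Icc 0 σ) :=
    (continuousOn_F2 hn.ne' μ).comp h.continuousOn_fst fun r hr => h.pos r hr
  have hcR : ContinuousOn (fun r => Q r ^ n) (Icc 0 σ) :=
    (continuousOn_rpow_const_Ioi n).comp h.continuousOn_fst fun r hr => h.pos r hr
  have := pos_of_deriv_pos (u := fun r => F2 d n c (Q r) μ - Q r ^ n * P r ^ 2 / 2)
    (u' := fun r => Q r ^ n * (-P r) * (W r - μ * (m + 1)) + m * Q r ^ n * P r ^ 2 / r)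
    (hcQ.sub ((hcR.mul (h.continuousOn_snd.pow 2)).div_const 2))
    (by simp [h.fst_zero, h.snd_zero, F2_one])
    (fun s hs => by
      have hq := h.pos s (Ioo_subset_Icc_self hs)
      have hs0 : s ≠ 0 := hs.1.ne'
      have e1 := (hasDerivAt_F2 (d := d) (c := c) hn.ne' μ hq).comp s (h.hasDerivAt_fst s hs)
      have e2 := (((h.hasDerivAt_fst s hs).rpow_const (p := n) (Or.inl hq.ne')).mul
        ((h.hasDerivAt_snd s hs).pow 2)).div_const 2
      refine (e1.sub e2).congr_deriv ?_
      rw [rpow_sub_one hq.ne']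
      simp only [radialForce, F1, hd, Pi.pow_apply]
      field_simp
      ring)
    (fun s hs => by
      have hq := h.pos s (Ioo_subset_Icc_self hs)
      have h1 := h.lt_thd (by linarith) hP s ⟨hs.1, hs.2.le⟩
      have h2 := neg_pos.2 (hP s hs)
      have h3 := sub_pos.2 h1
      have h4 := rpow_pos_of_pos hq n
      have h5 := hs.1
      positivity) r hr
  linarith

/-- The second energy estimate: the memory term is controlled by `F3`. -/
theorem thd_lt_F3 (h : IsRadialSolution m n c μ σ Q P W) (hn : 1 < n) (hd : d = m + 1)
    (hP : ∀ r ∈ Ioo 0 σ, P r < 0) :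
    ∀ r ∈ Ioc 0 σ, W r < F3 d n c (Q r) μ - F1 d n c (Q r) 0 := by
  intro r hr
  have hcQ : ContinuousOn (fun r => F3 d n c (Q r) μ - F1 d n c (Q r) μ) (Icc 0 σ) :=
    ((continuousOn_F3 hn.ne' μ).sub (continuousOn_F1 hn.ne' μ)).comp h.continuousOn_fst
      fun r hr => h.pos r hr
  have := pos_of_deriv_pos
    (u := fun r => F3 d n c (Q r) μ - F1 d n c (Q r) μ + μ * (m + 1) - W r)
    (u' := fun r => n * (-P r) * Q r ^ (-(n + 2)) *
      (F2 d n c (Q r) μ - Q r ^ n * P r ^ 2 / 2))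
    ((hcQ.add continuousOn_const).sub h.continuousOn_thd)
    (by simp [h.fst_zero, h.thd_zero, F3_one, F1_one])
    (fun s hs => by
      have hq := h.pos s (Ioo_subset_Icc_self hs)
      have e1 := (hasDerivAt_F3_sub_F1 (d := d) (c := c) hn.ne' μ hq).comp s
        (h.hasDerivAt_fst s hs)
      refine ((e1.add_const (μ * (m + 1))).sub (h.hasDerivAt_thd s hs)).congr_deriv ?_
      have e3 : Q s ^ (-(n + 2)) * Q s ^ n = (Q s ^ 2)⁻¹ := by
        rw [← rpow_add hq, show -(n + 2) + n = -(2:ℕ) by push_cast; ring, rpow_neg hq.le,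
          rpow_natCast]
      have e4 : n * -P s * Q s ^ (-(n + 2)) * (F2 d n c (Q s) μ - Q s ^ n * P s ^ 2 / 2) =
          n * -P s * Q s ^ (-(n + 2)) * F2 d n c (Q s) μ +
            n * P s ^ 3 / 2 * (Q s ^ (-(n + 2)) * Q s ^ n) := by ring
      rw [e4, e3]
      field_simp
      ring)
    (fun s hs => by
      have hq := h.pos s (Ioo_subset_Icc_self hs)
      have h1 := sub_pos.2 (h.rpow_mul_sq_lt_F2 hn hd hP s ⟨hs.1, hs.2.le⟩)
      have h2 := neg_pos.2 (hP s hs)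
      have h4 := rpow_pos_of_pos hq (-(n + 2))
      have h5 : 0 < n := by linarith
      positivity) r hr
  have e := F1_eq (d := d) (n := n) (c := c) (Q r) μ
  rw [hd] at e ⊢
  rw [hd] at this
  linarith

theorem radialForce_lt_F3 (h : IsRadialSolution m n c μ σ Q P W) (hn : 1 < n) (hd : d = m + 1)
    (hP : ∀ r ∈ Ioo 0 σ, P r < 0) {r : ℝ} (hr : r ∈ Ioc 0 σ) :
    radialForce n c (Q r) (P r) (W r) < F3 d n c (Q r) μ := by
  have h1 := h.thd_lt_F3 hn hd hP r hr
  have h2 := h.pos r ⟨hr.1.le, hr.2⟩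
  have h3 : 0 ≤ n * P r ^ 2 / (2 * Q r) := by
    have : 0 < n := by linarith
    positivity
  simp only [radialForce, F1] at h1 ⊢
  linarith

end IsRadialSolution

/-- The curve `u` satisfies the radial system with right-hand side `f` at `r`. -/
def RadialODE (m : ℕ) (f : ℝ × ℝ × ℝ → ℝ × ℝ × ℝ) (u : ℝ → ℝ × ℝ × ℝ) (r : ℝ) : Prop :=
  HasDerivAt (fun s => (u s).1) (f (u r)).1 r ∧
    HasDerivAt (fun s => (u s).2.1) ((f (u r)).2.1 - m * ((u r).2.1 / r)) r ∧
    HasDerivAt (fun s => (u s).2.2) (f (u r)).2.2 r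

theorem RadialODE.eqOn {m : ℕ} {f : ℝ × ℝ × ℝ → ℝ × ℝ × ℝ} {L : NNReal} (hf : LipschitzWith L f)
    {σ : ℝ} {u v : ℝ → ℝ × ℝ × ℝ} (hu : ContinuousOn u (Icc 0 σ)) (hv : ContinuousOn v (Icc 0 σ))
    (hu' : ∀ r ∈ Ioo 0 σ, RadialODE m f u r) (hv' : ∀ r ∈ Ioo 0 σ, RadialODE m f v r)
    (h0 : u 0 = v 0) : EqOn u v (Icc 0 σ) := by
  let D : ℝ → ℝ := fun r => ((u r).1 - (v r).1) ^ 2 + ((u r).2.1 - (v r).2.1) ^ 2 +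
    ((u r).2.2 - (v r).2.2) ^ 2
  have hanti : AntitoneOn (fun r => D r * exp (-(6 * L * r))) (Icc 0 σ) := by
    let D' : ℝ → ℝ := fun r =>
      2 * ((u r).1 - (v r).1) * ((f (u r)).1 - (f (v r)).1) +
      2 * ((u r).2.1 - (v r).2.1) *
        (((f (u r)).2.1 - m * ((u r).2.1 / r)) - ((f (v r)).2.1 - m * ((v r).2.1 / r))) +
      2 * ((u r).2.2 - (v r).2.2) * ((f (u r)).2.2 - (f (v r)).2.2)
    have hD : ∀ r ∈ Ioo 0 σ, HasDerivAt D (D' r) r := fun r hr => by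
      obtain ⟨a1, a2, a3⟩ := hu' r hr
      obtain ⟨b1, b2, b3⟩ := hv' r hr
      refine ((((a1.sub b1).pow 2).add ((a2.sub b2).pow 2)).add ((a3.sub b3).pow 2)).congr_deriv ?_
      simp [D']
    have hE : ∀ r ∈ Ioo 0 σ, HasDerivAt (fun r => D r * exp (-(6 * L * r)))
        (D' r * exp (-(6 * L * r)) + D r * (exp (-(6 * L * r)) * -(6 * L))) r := fun r hr => by
      refine (hD r hr).mul ?_
      refine (((hasDerivAt_id r).const_mul (6 * (L:ℝ))).neg.exp).congr_deriv ?_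
      simp
    refine antitoneOn_of_deriv_nonpos (convex_Icc 0 σ) (by fun_prop) (fun r hr => ?_) fun r hr => ?_
    · rw [interior_Icc] at hr
      exact (hE r hr).differentiableAt.differentiableWithinAt
    · rw [interior_Icc] at hr
      rw [(hE r hr).deriv]
      have hbound : D' r ≤ 6 * L * D r := by
        have hl := hf.norm_sub_le (u r) (v r)
        have c1 : |(f (u r)).1 - (f (v r)).1| ≤ L * ‖u r - v r‖ := (norm_fst_le _).trans hl
        have c2 : |(f (u r)).2.1 - (f (v r)).2.1| ≤ L * ‖u r - v r‖ :=
          ((norm_fst_le (f (u r) - f (v r)).2).trans (norm_snd_le _)).trans hl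
        have c3 : |(f (u r)).2.2 - (f (v r)).2.2| ≤ L * ‖u r - v r‖ :=
          ((norm_snd_le (f (u r) - f (v r)).2).trans (norm_snd_le _)).trans hl
        have d1 : |(u r).1 - (v r).1| ≤ ‖u r - v r‖ := norm_fst_le (u r - v r)
        have d2 : |(u r).2.1 - (v r).2.1| ≤ ‖u r - v r‖ :=
          (norm_fst_le (u r - v r).2).trans (norm_snd_le _)
        have d3 : |(u r).2.2 - (v r).2.2| ≤ ‖u r - v r‖ :=
          (norm_snd_le (u r - v r).2).trans (norm_snd_le _)
        have hDn : ‖u r - v r‖ ^ 2 ≤ D r := by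
          have hcase : ‖u r - v r‖ = |(u r).1 - (v r).1| ∨ ‖u r - v r‖ = |(u r).2.1 - (v r).2.1| ∨
              ‖u r - v r‖ = |(u r).2.2 - (v r).2.2| := by
            simp only [Prod.norm_def, Prod.fst_sub, Prod.snd_sub, norm_eq_abs]
            rcases max_choice |(u r).1 - (v r).1|
              (max |(u r).2.1 - (v r).2.1| |(u r).2.2 - (v r).2.2|) with h | h
            · exact Or.inl h
            · rw [h]
              exact Or.inr (max_choice _ _)
          rcases hcase with h | h | h <;> rw [h, sq_abs] <;> simp only [D] <;> nlinarith [
            sq_nonneg ((u r).1 - (v r).1), sq_nonneg ((u r).2.1 - (v r).2.1),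
            sq_nonneg ((u r).2.2 - (v r).2.2)]
        have hprod : ∀ a b : ℝ, |a| ≤ ‖u r - v r‖ → |b| ≤ L * ‖u r - v r‖ →
            2 * a * b ≤ 2 * L * ‖u r - v r‖ ^ 2 := fun a b ha hb => by
          have := mul_le_mul ha hb (abs_nonneg b) (norm_nonneg _)
          rw [← abs_mul] at this
          linarith [le_abs_self (a * b)]
        have hdamp : 0 ≤ m * (((u r).2.1 - (v r).2.1) ^ 2 / r) := by
          have := hr.1
          positivity
        have hsplit : D' r = 2 * ((u r).1 - (v r).1) * ((f (u r)).1 - (f (v r)).1) +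
            2 * ((u r).2.1 - (v r).2.1) * ((f (u r)).2.1 - (f (v r)).2.1) +
            2 * ((u r).2.2 - (v r).2.2) * ((f (u r)).2.2 - (f (v r)).2.2) -
            2 * (m * (((u r).2.1 - (v r).2.1) ^ 2 / r)) := by
          simp only [D']
          ring
        have hL : (L:ℝ) * ‖u r - v r‖ ^ 2 ≤ L * D r := by gcongr
        linarith [hprod _ _ d1 c1, hprod _ _ d2 c2, hprod _ _ d3 c3]
      nlinarith [exp_pos (-(6 * L * r))]
  intro r hr
  have hle := hanti (left_mem_Icc.2 (hr.1.trans hr.2)) hr hr.1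
  have hD0 : D 0 = 0 := by simp [D, h0]
  simp only [hD0, zero_mul] at hle
  have hDr : D r ≤ 0 := by
    by_contra! hpos
    exact absurd hle (not_le.2 (mul_pos hpos (exp_pos _)))
  simp only [D] at hDr
  have s1 := sq_nonneg ((u r).1 - (v r).1)
  have s2 := sq_nonneg ((u r).2.1 - (v r).2.1)
  have s3 := sq_nonneg ((u r).2.2 - (v r).2.2)
  refine Prod.ext ?_ (Prod.ext ?_ ?_) <;> refine sub_eq_zero.1 (pow_eq_zero_iff two_ne_zero |>.1 ?_)
  all_goals linarith

/-- The right-hand side of the radial system for the magma equation. -/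
def magmaField (n c : ℝ) (x : ℝ × ℝ × ℝ) : ℝ × ℝ × ℝ :=
  (x.2.1, radialForce n c x.1 x.2.1 x.2.2, -(n * x.2.1 ^ 3 / (2 * x.1 ^ 2)))

theorem contDiffOn_magmaField (n c : ℝ) : ContDiffOn ℝ 2 (magmaField n c) {x | 0 < x.1} := by
  intro x hx
  have hx : 0 < x.1 := hx
  refine ContDiffAt.contDiffWithinAt ?_
  have hrpow : ContDiffAt ℝ 2 (fun x : ℝ × ℝ × ℝ => x.1 ^ (1 - n)) x :=
    contDiffAt_fst.rpow_const_of_ne hx.ne'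
  have hlog : ContDiffAt ℝ 2 (fun x : ℝ × ℝ × ℝ => Real.log x.1) x := contDiffAt_fst.log hx.ne'
  have hp : ContDiffAt ℝ 2 (fun x : ℝ × ℝ × ℝ => x.2.1) x := by fun_prop
  have hw : ContDiffAt ℝ 2 (fun x : ℝ × ℝ × ℝ => x.2.2) x := by fun_prop
  have hq : ContDiffAt ℝ 2 (fun x : ℝ × ℝ × ℝ => x.1) x := by fun_prop
  refine hp.prodMk (ContDiffAt.prodMk ?_ ?_)
  · refine ((ContDiffAt.add (ContDiffAt.sub ?_ ?_) contDiffAt_const).sub ?_).add hw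
    · exact contDiffAt_const.mul (hrpow.sub contDiffAt_const)
    · exact contDiffAt_const.mul hlog
    · exact (contDiffAt_const.mul (hp.pow 2)).div (contDiffAt_const.mul hq) (by positivity)
  · exact ((contDiffAt_const.mul (hp.pow 3)).div (contDiffAt_const.mul (hq.pow 2))
      (by positivity)).neg

namespace IsRadialSolution

variable {m : ℕ} {n c μ σ : ℝ} {Q P W : ℝ → ℝ}

/-- The second-order force is stationary exactly where `P` vanishes. -/
theorem hasDerivAt_radialForce (h : IsRadialSolution m n c μ σ Q P W) (hn : 1 < n) {r : ℝ}
    (hr : r ∈ Ioo 0 σ) :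
    HasDerivAt (fun s => radialForce n c (Q s) (P s) (W s))
      (P r * (Q r ^ (-n) - n / c / Q r -
        n * (radialForce n c (Q r) (P r) (W r) - m * (P r / r)) / Q r)) r := by
  have hq := h.pos r (Ioo_subset_Icc_self hr)
  have h1 := (hasDerivAt_F1 (d := 0) (c := c) hn.ne' 0 hq).comp r (h.hasDerivAt_fst r hr)
  have h2 := (((h.hasDerivAt_snd r hr).pow 2).const_mul n).div
    ((h.hasDerivAt_fst r hr).const_mul 2) (by positivity)
  refine ((h1.sub h2).add (h.hasDerivAt_thd r hr)).congr_deriv ?_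
  simp only [Pi.pow_apply]
  generalize radialForce n c (Q r) (P r) (W r) - m * (P r / r) = a
  generalize Q r ^ (-n) = b
  field_simp
  ring

theorem magmaODE {d : ℝ} (h : IsRadialSolution m n c μ σ Q P W) (hn : 1 < n) (hd : d = m + 1)
    {r : ℝ} (hr : r ∈ Ioo 0 σ) : magmaODE d n c Q r := by
  have hq := h.pos r (Ioo_subset_Icc_self hr)
  have hr0 : r ≠ 0 := hr.1.ne'
  have hnear : ∀ᶠ s in 𝓝 r, s ∈ Ioo 0 σ := isOpen_Ioo.mem_nhds hr
  have e1 : ∀ s ∈ Ioo 0 σ, deriv Q =ᶠ[𝓝 s] P := fun s hs => by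
    filter_upwards [isOpen_Ioo.mem_nhds hs] with t ht using (h.hasDerivAt_fst t ht).deriv
  have e2 : ∀ s ∈ Ioo 0 σ, deriv (deriv Q) s =
      radialForce n c (Q s) (P s) (W s) - m * (P s / s) := fun s hs => by
    rw [(e1 s hs).deriv_eq, (h.hasDerivAt_snd s hs).deriv]
  have hQ := h.hasDerivAt_fst r hr
  have hP := h.hasDerivAt_snd r hr
  have hdiv : HasDerivAt (fun s => P s / s) _ r := hP.div (hasDerivAt_id r) hr0
  have hG := h.hasDerivAt_radialForce hn hr
  have hpow : HasDerivAt (fun s => Q s ^ n) _ r := hQ.rpow_const (p := n) (Or.inl hq.ne')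
  have hflux := hpow.mul (hG.sub (hdiv.const_mul (m:ℝ)))
  have t1 : deriv (fun s => Q s ^ n * deriv (deriv Q) s) r = _ :=
    (EventuallyEq.deriv_eq (by filter_upwards [hnear] with s hs; rw [e2 s hs]; rfl)).trans
      hflux.deriv
  have t2 : deriv (fun s => deriv Q s / s) r = _ :=
    (EventuallyEq.deriv_eq (by filter_upwards [e1 r hr] with s hs; rw [hs])).trans hdiv.deriv
  rw [_root_.magmaODE, t1, t2, hpow.deriv, hQ.deriv, hd]
  rw [rpow_sub_one hq.ne', rpow_neg hq.le]
  have hqn := rpow_pos_of_pos hq n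
  simp only [Pi.sub_apply]
  generalize radialForce n c (Q r) (P r) (W r) = a
  generalize Q r ^ n = b at *
  field_simp
  ring

end IsRadialSolution

theorem eq_of_hasDerivAt_of_tendsto_deriv_right {u : ℝ → ℝ} {a u' l : ℝ} (hu : HasDerivAt u u' a)
    (hdiff : ∀ᶠ r in 𝓝[>] a, DifferentiableAt ℝ u r) (hl : Tendsto (deriv u) (𝓝[>] a) (𝓝 l)) :
    l = u' := by
  have h := hasDerivWithinAt_Ici_of_tendsto_deriv (s := {r | DifferentiableAt ℝ u r})
    (fun r hr => hr.differentiableWithinAt) hu.continuousAt.continuousWithinAt hdiff hl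
  exact (uniqueDiffOn_Ici a a self_mem_Ici).eq_deriv _ h hu.hasDerivWithinAt

/-- A solution of the initial value problem solves the radial system. -/
theorem isIVPSolutionOn.exists_isRadialSolution {m : ℕ} {d n c μ σ τ : ℝ} {Q : ℝ → ℝ}
    (h : isIVPSolutionOn d n c μ Q σ) (hn : 1 < n) (hd : d = m + 1) (hμ : μ ≠ 0) (hσ : 0 < σ)
    (hτ : τ < σ) (hpos : ∀ r ∈ Ioc 0 σ, 0 < Q r) :
    ∃ W, IsRadialSolution m n c μ τ Q (deriv Q) W := by
  obtain ⟨hC, hode, hQ0, hP0, hμ0⟩ := h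
  have hat : ∀ r ∈ Ioo 0 σ, ContDiffAt ℝ 3 Q r := fun r hr =>
    hC.contDiffAt (Icc_mem_nhds hr.1 hr.2)
  have hat1 : ∀ r ∈ Ioo 0 σ, ContDiffAt ℝ 2 (deriv Q) r := fun r hr =>
    (hat r hr).derivWithin (m := 2) (n := 3) (by norm_num)
  have hat2 : ∀ r ∈ Ioo 0 σ, ContDiffAt ℝ 1 (deriv (deriv Q)) r := fun r hr =>
    (hat1 r hr).derivWithin (by norm_num)
  have hP0' : HasDerivAt (deriv Q) μ 0 := by
    rw [← hμ0]
    exact (differentiableAt_of_deriv_ne_zero (by rwa [hμ0])).hasDerivAt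
  have hlim2 : Tendsto (deriv (deriv Q)) (𝓝[>] 0) (𝓝 μ) := by
    have hcont : ContinuousWithinAt (iteratedDerivWithin 2 Q (Icc 0 σ)) (Icc 0 σ) 0 :=
      hC.continuousOn_iteratedDerivWithin (by norm_num) (uniqueDiffOn_Icc hσ) 0
        (left_mem_Icc.2 hσ.le)
    have hl : Tendsto (deriv (deriv Q)) (𝓝[>] 0) (𝓝 (iteratedDerivWithin 2 Q (Icc 0 σ) 0)) := by
      rw [← nhdsWithin_Ioo_eq_nhdsGT hσ]
      refine (hcont.tendsto.mono_left (nhdsWithin_mono _ Ioo_subset_Icc_self)).congr' ?_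
      filter_upwards [self_mem_nhdsWithin] with r hr
      rw [iteratedDerivWithin_eq_iteratedDeriv (uniqueDiffOn_Icc hσ)
        ((hat r hr).of_le (by norm_num)) (Ioo_subset_Icc_self hr), iteratedDeriv_succ,
        iteratedDeriv_one]
    rwa [eq_of_hasDerivAt_of_tendsto_deriv_right hP0' (by
      filter_upwards [Ioo_mem_nhdsGT hσ] with r hr
        using (hat1 r hr).differentiableAt two_ne_zero) hl] at hl
  have hlim1 : Tendsto (fun r => deriv Q r / r) (𝓝[>] 0) (𝓝 μ) := by
    have := (hasDerivAt_iff_tendsto_slope.1 hP0').mono_left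
      (nhdsWithin_mono _ fun r (hr : 0 < r) => hr.ne')
    refine this.congr fun r => ?_
    simp [slope_def_field, hP0]
  let w : ℝ → ℝ := fun r => deriv (deriv Q) r + m * (deriv Q r / r) - F1 0 n c (Q r) 0 +
    n * deriv Q r ^ 2 / (2 * Q r)
  let W : ℝ → ℝ := Function.update w 0 (μ * (m + 1))
  have hWw : ∀ r, r ≠ 0 → W r = w r := fun r hr => Function.update_of_ne hr _ _
  have hpos' : ∀ r ∈ Icc 0 τ, 0 < Q r := fun r hr => by
    rcases hr.1.eq_or_lt with rfl | h0
    · rw [hQ0]; exact one_pos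
    · exact hpos r ⟨h0, hr.2.trans hτ.le⟩
  have hIoo : ∀ r ∈ Ioo 0 τ, r ∈ Ioo 0 σ := fun r hr => ⟨hr.1, hr.2.trans hτ⟩
  have hderiv3 : ∀ r ∈ Ioo 0 σ, HasDerivAt w (-(n * deriv Q r ^ 3 / (2 * Q r ^ 2))) r := by
    intro r hr
    have hq := hpos r ⟨hr.1, hr.2.le⟩
    have hr0 : r ≠ 0 := hr.1.ne'
    have d1 : HasDerivAt Q (deriv Q r) r :=
      ((hat r hr).differentiableAt three_ne_zero).hasDerivAt
    have d2 : HasDerivAt (deriv Q) (deriv (deriv Q) r) r :=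
      ((hat1 r hr).differentiableAt two_ne_zero).hasDerivAt
    have d3 : HasDerivAt (deriv (deriv Q)) (deriv (deriv (deriv Q)) r) r :=
      ((hat2 r hr).differentiableAt one_ne_zero).hasDerivAt
    have hdiv : HasDerivAt (fun s => deriv Q s / s) _ r := d2.div (hasDerivAt_id r) hr0
    have hpow : HasDerivAt (fun s => Q s ^ n) _ r := d1.rpow_const (p := n) (Or.inl hq.ne')
    have hflux : HasDerivAt (fun s => Q s ^ n * deriv (deriv Q) s) _ r := hpow.mul d3
    have hF := (hasDerivAt_F1 (d := 0) (c := c) hn.ne' 0 hq).comp r d1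
    have hsq := ((d2.pow 2).const_mul n).div (d1.const_mul 2) (by positivity)
    have heq := hode r hr
    rw [magmaODE, hflux.deriv, hdiv.deriv, hpow.deriv, hd, rpow_sub_one hq.ne'] at heq
    refine (((d3.add (hdiv.const_mul (m:ℝ))).sub hF).add hsq).congr_deriv ?_
    rw [rpow_neg hq.le]
    have hqn := rpow_pos_of_pos hq n
    simp only [Pi.pow_apply] at heq ⊢
    generalize Q r ^ n = b at *
    have h3 : deriv (deriv (deriv Q)) r =
        (deriv Q r - 1 / c * (deriv Q r * n * (b / Q r)) - deriv Q r * n * (b / Q r) *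
          deriv (deriv Q) r - m * b * ((deriv (deriv Q) r * r - deriv Q r * 1) / r ^ 2)) / b := by
      rw [eq_div_iff hqn.ne']
      linear_combination heq
    rw [h3]
    field_simp
    ring
  refine ⟨W, ?_, ?_, ?_, hQ0, hP0, Function.update_self _ _ _, hpos', ?_, ?_, ?_⟩
  · exact hC.continuousOn.mono (Icc_subset_Icc_right hτ.le)
  · intro r hr
    rcases hr.1.eq_or_lt with rfl | h0
    · exact hP0'.continuousAt.continuousWithinAt
    · exact (hat1 r ⟨h0, hr.2.trans_lt hτ⟩).continuousAt.continuousWithinAt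
  · intro r hr
    rcases hr.1.eq_or_lt with rfl | h0
    · have hQlim : Tendsto Q (𝓝[>] 0) (𝓝 1) := by
        rw [← nhdsWithin_Ioo_eq_nhdsGT hσ, ← hQ0]
        exact (hC.continuousOn 0 (left_mem_Icc.2 hσ.le)).tendsto.mono_left
          (nhdsWithin_mono _ Ioo_subset_Icc_self)
      have hPlim : Tendsto (deriv Q) (𝓝[>] 0) (𝓝 0) := by
        have := hP0'.continuousAt.tendsto.mono_left (nhdsWithin_le_nhds (s := Ioi 0))
        rwa [hP0] at this
      have hFlim : Tendsto (fun r => F1 0 n c (Q r) 0) (𝓝[>] 0) (𝓝 0) := by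
        have := (hasDerivAt_F1 (d := 0) (c := c) hn.ne' 0 one_pos).continuousAt.tendsto.comp hQlim
        rwa [F1_one, zero_mul] at this
      have hw : Tendsto w (𝓝[>] 0) (𝓝 (μ * (m + 1))) := by
        have := ((hlim2.add (hlim1.const_mul (m:ℝ))).sub hFlim).add
          (((hPlim.pow 2).const_mul n).div (hQlim.const_mul 2) (by norm_num))
        refine this.trans (le_of_eq ?_)
        congr 1
        ring
      have hW : ContinuousWithinAt W (Ici 0) 0 := by
        rw [← continuousWithinAt_Ioi_iff_Ici, ContinuousWithinAt]
        refine (Function.update_self (0:ℝ) (μ * ((m:ℝ) + 1)) w ▸ hw).congr' ?_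
        filter_upwards [self_mem_nhdsWithin] with r hr using (hWw r (ne_of_gt hr)).symm
      exact hW.mono Icc_subset_Ici_self
    · refine ((hderiv3 r ⟨h0, hr.2.trans_lt hτ⟩).continuousAt.congr ?_).continuousWithinAt
      filter_upwards [lt_mem_nhds h0] with s hs using (hWw s hs.ne').symm
  · exact fun r hr => ((hat r (hIoo r hr)).differentiableAt three_ne_zero).hasDerivAt
  · intro r hr
    refine ((hat1 r (hIoo r hr)).differentiableAt two_ne_zero).hasDerivAt.congr_deriv ?_
    rw [hWw r hr.1.ne']
    simp only [radialForce, w]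
    ring
  · intro r hr
    refine (hderiv3 r (hIoo r hr)).congr_of_eventuallyEq ?_
    filter_upwards [lt_mem_nhds hr.1] with s hs using hWw s hs.ne'

section Thresholds

variable {d n c Qs : ℝ}

/-- The slope of `F3` in `μ` grows at least linearly away from its zero `Qs`. -/
theorem exists_le_F3_slope (hn : 1 < n) (hd : 0 < d) (hQs : Qs ∈ Ioo (0:ℝ) 1)
    (hz : F3 d n c Qs 1 - F3 d n c Qs 0 = 0)
    (hu : ∀ q ∈ Ioo (0:ℝ) 1, F3 d n c q 1 - F3 d n c q 0 = 0 → q = Qs) :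
    ∃ κ > 0, ∀ q ∈ Icc Qs 1, κ * (q - Qs) ≤ F3 d n c q 1 - F3 d n c q 0 := by
  set h : ℝ → ℝ := fun q => F3 d n c q 1 - F3 d n c q 0 with hh
  have hcont : ContinuousOn h (Ioi 0) :=
    (continuousOn_F3 hn.ne' 1).sub (continuousOn_F3 hn.ne' 0)
  have h1 : 0 < h 1 := by simp [hh, F3_one, hd]
  have hpos : ∀ q ∈ Ioc Qs 1, 0 < h q := by
    intro q hq
    by_contra! hle
    obtain ⟨p, hp, hp0⟩ := intermediate_value_Icc hq.2
      (hcont.mono fun x hx => hQs.1.trans (hq.1.trans_le hx.1)) ⟨hle, h1.le⟩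
    have hp1 : p ≠ 1 := fun e => by rw [e] at hp0; exact h1.ne' hp0
    have := hu p ⟨hQs.1.trans (hq.1.trans_le hp.1), lt_of_le_of_ne hp.2 hp1⟩ hp0
    exact absurd (hq.1.trans_le hp.1) (by rw [this]; exact lt_irrefl _)
  have hder := (hasDerivAt_F3 (d := d) (c := c) hn.ne' 1 hQs.1).sub
    (hasDerivAt_F3 (d := d) (c := c) hn.ne' 0 hQs.1)
  have hder' : HasDerivAt h
      (-(n * ((F2 d n c Qs 1 - F2 d n c Qs 0) * Qs ^ (-(n + 2))))) Qs :=
    hder.congr_deriv (by ring)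
  have hslope : ∀ q ∈ Icc Qs 1, 0 < dslope h Qs q := by
    intro q hq
    rcases hq.1.eq_or_lt with rfl | hlt
    · rw [dslope_same, hder'.deriv]
      have := mul_neg_of_neg_of_pos (F2_slope_neg (c := c) hn.ne' hd hQs.1 hQs.2)
        (rpow_pos_of_pos hQs.1 (-(n + 2)))
      nlinarith
    · rw [dslope_of_ne _ hlt.ne', slope_def_field, show h Qs = 0 from hz, sub_zero]
      exact div_pos (hpos q ⟨hlt, hq.2⟩) (sub_pos.2 hlt)
  have hdc : ContinuousOn (dslope h Qs) (Ioi 0) :=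
    (continuousOn_dslope (Ioi_mem_nhds hQs.1)).2 ⟨hcont, hder'.differentiableAt⟩
  obtain ⟨p, hp, hmin⟩ := isCompact_Icc.exists_isMinOn ⟨Qs, left_mem_Icc.2 hQs.2.le⟩
    (hdc.mono fun x (hx : x ∈ Icc Qs 1) => hQs.1.trans_le hx.1)
  refine ⟨_, hslope p hp, fun q hq => ?_⟩
  have h2 := sub_smul_dslope h Qs q
  rw [show h Qs = 0 from hz, sub_zero, smul_eq_mul] at h2
  rw [show F3 d n c q 1 - F3 d n c q 0 = h q from rfl, ← h2, mul_comm]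
  exact mul_le_mul_of_nonneg_left (hmin hq) (sub_nonneg.2 hq.1)

theorem F3_le_of_le_mu3 (hn : 1 < n) (hQs : 0 < Qs)
    (hpos : ∀ q ∈ Ioo Qs 1, 0 < F3 d n c q 1 - F3 d n c q 0) {ν : ℝ}
    (hν : ∀ q ∈ Ioo Qs 1, ν ≤ mu3 d n c q) (μ : ℝ) {q : ℝ} (hq : q ∈ Ioo Qs 1) :
    F3 d n c q μ ≤ (F3 d n c q 1 - F3 d n c q 0) * (μ - ν) := by
  have h := hν q hq
  rw [mu3, le_div_iff₀ (hpos q hq)] at h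
  rw [F3_affine hn.ne' μ (hQs.trans hq.1)]
  linarith

/-- At the zero of its slope, `F3` is nonpositive as soon as `mu3` is bounded below. -/
theorem F3_nonpos_of_le_mu3 (hn : 1 < n) (hQs : Qs ∈ Ioo (0:ℝ) 1)
    (hz : F3 d n c Qs 1 - F3 d n c Qs 0 = 0)
    (hpos : ∀ q ∈ Ioo Qs 1, 0 < F3 d n c q 1 - F3 d n c q 0) {ν : ℝ}
    (hν : ∀ q ∈ Ioo Qs 1, ν ≤ mu3 d n c q) (μ : ℝ) : F3 d n c Qs μ ≤ 0 := by
  have hcont : ∀ μ, ContinuousAt (fun q => F3 d n c q μ) Qs := fun μ =>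
    (continuousOn_F3 hn.ne' μ).continuousAt (Ioi_mem_nhds hQs.1)
  have hr : Tendsto (fun q => (F3 d n c q 1 - F3 d n c q 0) * (μ - ν)) (𝓝[>] Qs) (𝓝 0) := by
    have := (((hcont 1).sub (hcont 0)).mul_const (μ - ν)).tendsto.mono_left
      (nhdsWithin_le_nhds (s := Ioi Qs))
    simpa [hz] using this
  refine le_of_tendsto_of_tendsto ((hcont μ).tendsto.mono_left nhdsWithin_le_nhds) hr ?_
  filter_upwards [Ioo_mem_nhdsGT hQs.2] with q hq using F3_le_of_le_mu3 hn hQs.1 hpos hν μ hq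

/-- `mu2` takes negative values close to `1`. -/
theorem exists_mu2_neg (hn : 1 < n) (hd : 0 < d) (hc : 0 < c) (hcn : c < n)
    (hQs : Qs ∈ Ioo (0:ℝ) 1) : ∃ q ∈ Ioo Qs 1, mu2 d n c q < 0 := by
  have hder := hasDerivAt_F1 (d := d) (c := c) hn.ne' 0 one_pos
  have hneg : (1:ℝ) ^ (-n) - n / c / 1 < 0 := by
    rw [one_rpow, div_one, sub_neg, one_lt_div hc]
    exact hcn
  have hev : ∀ᶠ q in 𝓝[<] (1:ℝ), 0 < F1 d n c q 0 := by
    have hs := (hasDerivAt_iff_tendsto_slope.1 hder).eventually_lt_const hneg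
    have hs' := hs.filter_mono (nhdsWithin_mono _ fun q (hq : q < 1) => hq.ne)
    filter_upwards [hs', self_mem_nhdsWithin] with q h1 (h2 : q < 1)
    rw [slope_def_field, F1_one, zero_mul, sub_zero] at h1
    by_contra! h3
    exact absurd h1 (not_lt.2 (div_nonneg_of_nonpos h3 (by linarith)))
  obtain ⟨a, ha, hsub⟩ := mem_nhdsLT_iff_exists_Ioo_subset.1 hev
  obtain ⟨q, hq1, hq2⟩ := exists_between (max_lt hQs.2 ha)
  have hqs := (le_max_left _ _).trans_lt hq1
  have hqa := (le_max_right _ _).trans_lt hq1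
  have hq0 := hQs.1.trans hqs
  refine ⟨q, ⟨hqs, hq2⟩, ?_⟩
  have hF2 : F2 d n c q 0 < 0 := by
    have hanti : StrictMonoOn (fun x => F2 d n c x 0) (Icc q 1) := by
      refine strictMonoOn_of_deriv_pos (convex_Icc q 1)
        ((continuousOn_F2 hn.ne' 0).mono fun x hx => hq0.trans_le hx.1) fun x hx => ?_
      rw [interior_Icc] at hx
      have hx0 := hq0.trans hx.1
      rw [(hasDerivAt_F2 hn.ne' 0 hx0).deriv]
      exact mul_pos (hsub ⟨hqa.trans hx.1, hx.2⟩) (rpow_pos_of_pos hx0 n)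
    have := hanti (left_mem_Icc.2 hq2.le) (right_mem_Icc.2 hq2.le) hq2
    simpa only [F2_one] using this
  rw [mu2]
  exact div_neg_of_pos_of_neg (neg_pos.2 hF2) (F2_slope_neg hn.ne' hd hq0 hq2)

theorem lt_mu2_of_F2_pos (hn : 1 < n) (hd : 0 < d) {μ q : ℝ} (hq : q ∈ Ioo (0:ℝ) 1)
    (h : 0 < F2 d n c q μ) : μ < mu2 d n c q := by
  rw [F2_affine hn.ne' μ hq.1] at h
  rw [mu2, lt_div_iff_of_neg (F2_slope_neg hn.ne' hd hq.1 hq.2)]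
  linarith

end Thresholds

/-- A positive decreasing radial profile cannot be driven by a force of the order of its height. -/
theorem false_of_radial_force_le {m : ℕ} {v P g : ℝ → ℝ} {κ : ℝ} (hκ : 0 < κ)
    (hvc : ContinuousOn v (Ici 0)) (hPc : ContinuousOn P (Ici 0)) (hP0 : P 0 = 0)
    (hv : ∀ r > 0, HasDerivAt v (P r) r)
    (hP : ∀ r > 0, HasDerivAt P (g r - m * (P r / r)) r)
    (hvpos : ∀ r > 0, 0 < v r) (hPneg : ∀ r > 0, P r < 0) (hg : ∀ r > 0, g r ≤ -(κ * v r)) :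
    False := by
  have hm : (0:ℝ) < m + 1 := by positivity
  have hpow : ∀ r > 0, ∀ k : ℕ, HasDerivAt (fun s : ℝ => s ^ k) (k * (r ^ k / r)) r := by
    intro r hr k
    refine (hasDerivAt_pow k r).congr_deriv ?_
    rcases k with _ | k
    · simp
    · have := hr.ne'
      rw [Nat.add_sub_cancel, pow_succ, mul_div_cancel_right₀ _ this]
  have hw : ∀ r > 0, HasDerivAt (fun s => -(s ^ m * P s)) (-(r ^ m * g r)) r := by
    intro r hr
    have := hr.ne'
    refine ((hpow r hr m).mul (hP r hr)).neg.congr_deriv ?_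
    field_simp
    ring
  have hwmono : MonotoneOn (fun s => -(s ^ m * P s)) (Ici 0) := by
    refine monotoneOn_of_deriv_nonneg (convex_Ici 0) (by fun_prop) ?_ ?_
    · rw [interior_Ici]
      exact fun r hr => (hw r hr).differentiableAt.differentiableWithinAt
    · rw [interior_Ici]
      intro r hr
      rw [(hw r hr).deriv]
      have h1 := mul_pos hκ (hvpos r hr)
      have h2 := hg r hr
      have h3 : (0:ℝ) < r ^ m := pow_pos hr m
      nlinarith
  have hφ : ∀ r > 0, κ * v r * r / (m + 1) ≤ -P r := by
    have hd : ∀ r > 0, HasDerivAt (fun s => -(s ^ m * P s) - κ / (m + 1) * (s ^ (m + 1) * v s))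
        (-(r ^ m * g r) - κ * v r * r ^ m - κ / (m + 1) * r ^ (m + 1) * P r) r := by
      intro r hr
      have := hr.ne'
      refine ((hw r hr).sub (((hpow r hr (m + 1)).mul (hv r hr)).const_mul
        (κ / (m + 1)))).congr_deriv ?_
      push_cast
      field_simp
      ring
    have hmono : MonotoneOn (fun s => -(s ^ m * P s) - κ / (m + 1) * (s ^ (m + 1) * v s))
        (Ici 0) := by
      refine monotoneOn_of_deriv_nonneg (convex_Ici 0) (by fun_prop) ?_ ?_
      · rw [interior_Ici]
        exact fun r hr => (hd r hr).differentiableAt.differentiableWithinAt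
      · rw [interior_Ici]
        intro r (hr : 0 < r)
        rw [(hd r hr).deriv]
        have h2 := hg r hr
        have h3 : (0:ℝ) < r ^ m := pow_pos hr m
        have h4 : 0 < κ / (m + 1) * r ^ (m + 1) * (-P r) :=
          mul_pos (by positivity) (neg_pos.2 (hPneg r hr))
        nlinarith
    intro r hr
    have h0 := hmono self_mem_Ici (mem_Ici.2 hr.le) hr.le
    simp only [hP0, mul_zero, neg_zero, zero_pow (Nat.succ_ne_zero m), zero_mul, sub_zero] at h0
    have h3 : (0:ℝ) < r ^ m := pow_pos hr m
    have : r ^ m * (κ * v r * r / (m + 1)) ≤ r ^ m * -P r := by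
      have e : r ^ m * (κ * v r * r / (m + 1)) = κ / (m + 1) * (r ^ (m + 1) * v r) := by
        field_simp
        ring
      rw [e]
      linarith
    exact le_of_mul_le_mul_left this h3
  set r₁ : ℝ := max 1 (2 * (m + 1) ^ 2 / κ) with hr₁
  have hr₁1 : 1 ≤ r₁ := le_max_left _ _
  set ω : ℝ := -P 1 with hω
  have hωpos : 0 < ω := neg_pos.2 (hPneg 1 one_pos)
  have hψ : ∀ r > 0, HasDerivAt (fun s => s ^ (m + 1) * v s + ω / 2 * s)
      ((m + 1) * r ^ m * v r + r ^ (m + 1) * P r + ω / 2) r := by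
    intro r hr
    have := hr.ne'
    refine (((hpow r hr (m + 1)).mul (hv r hr)).add
      ((hasDerivAt_id r).const_mul (ω / 2))).congr_deriv ?_
    push_cast
    field_simp
    ring
  have hanti : AntitoneOn (fun s => s ^ (m + 1) * v s + ω / 2 * s) (Ici r₁) := by
    have hsub : Ici r₁ ⊆ Ici 0 := Ici_subset_Ici.2 (by linarith)
    have hvc' := hvc.mono hsub
    refine antitoneOn_of_deriv_nonpos (convex_Ici r₁) (by fun_prop) ?_ ?_
    · rw [interior_Ici]
      exact fun r (hr : r₁ < r) =>
        (hψ r (by linarith)).differentiableAt.differentiableWithinAt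
    · rw [interior_Ici]
      intro r (hr : r₁ < r)
      have hr1 : 1 < r := by linarith
      have hr0 : 0 < r := by linarith
      rw [(hψ r hr0).deriv]
      have hw1 := hwmono (mem_Ici.2 zero_le_one) (mem_Ici.2 hr0.le) hr1.le
      simp only [one_pow, one_mul] at hw1
      have hκr : 2 * (m + 1) ^ 2 ≤ κ * r ^ 2 := by
        have : 2 * (m + 1) ^ 2 / κ ≤ r := (le_max_right _ _).trans hr.le
        rw [div_le_iff₀ hκ] at this
        nlinarith
      have h1 := hφ r hr0
      rw [div_le_iff₀ hm] at h1
      have h2 : 2 * (m + 1) * v r ≤ -(r * P r) := by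
        have : (m + 1) * (2 * (m + 1) * v r) ≤ (m + 1) * -(r * P r) := by
          nlinarith [mul_le_mul_of_nonneg_right hκr (hvpos r hr0).le,
            mul_le_mul_of_nonneg_left h1 hr0.le]
        exact le_of_mul_le_mul_left this hm
      have h3 : (0:ℝ) < r ^ m := pow_pos hr0 m
      have h4 := mul_le_mul_of_nonneg_left h2 h3.le
      rw [pow_succ]
      have h5 : ω ≤ r * -(r ^ m * P r) := by
        have : 0 < -(r ^ m * P r) := hωpos.trans_le hw1
        nlinarith
      nlinarith
  set s := r₁ + 2 * (r₁ ^ (m + 1) * v r₁) / ω with hs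
  have hr₁pos : 0 < r₁ := by linarith
  have hv1 : 0 < r₁ ^ (m + 1) * v r₁ := mul_pos (by positivity) (hvpos _ hr₁pos)
  have hsr : r₁ ≤ s := by rw [hs]; linarith [div_pos (mul_pos two_pos hv1) hωpos]
  have hfin := hanti self_mem_Ici (mem_Ici.2 hsr) hsr
  have hspos : 0 < s ^ (m + 1) * v s :=
    mul_pos (pow_pos (hr₁pos.trans_le hsr) _) (hvpos _ (hr₁pos.trans_le hsr))
  have : ω / 2 * s = ω / 2 * r₁ + r₁ ^ (m + 1) * v r₁ := by
    rw [hs]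
    field_simp
  simp only [this] at hfin
  linarith

namespace IsRadialSolution

variable {m : ℕ} {n c μ σ : ℝ} {Q P W : ℝ → ℝ}

theorem radialForce_ne_zero (h : IsRadialSolution m n c μ σ Q P W) (hn : 1 < n) {r₀ : ℝ}
    (hr₀ : r₀ ∈ Ioo 0 σ) (hP : ∀ r ∈ Ioo 0 r₀, P r < 0) (hP₀ : P r₀ = 0) :
    radialForce n c (Q r₀) (P r₀) (W r₀) ≠ 0 := by
  intro hg₀
  set g : ℝ → ℝ := fun s => radialForce n c (Q s) (P s) (W s) with hg
  have h0 := hr₀.1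
  have hsub : Icc (r₀ / 2) r₀ ⊆ Ioo 0 σ := fun r hr =>
    ⟨by linarith [hr.1], hr.2.trans_lt hr₀.2⟩
  have hgc : ContinuousOn g (Icc (r₀ / 2) r₀) := fun r hr =>
    (h.hasDerivAt_radialForce hn (hsub hr)).continuousAt.continuousWithinAt
  have hQc : ContinuousOn Q (Icc (r₀ / 2) r₀) := h.continuousOn_fst.mono
    (hsub.trans Ioo_subset_Icc_self)
  have hPc : ContinuousOn P (Icc (r₀ / 2) r₀) := h.continuousOn_snd.mono
    (hsub.trans Ioo_subset_Icc_self)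
  have hQ0 : ∀ r ∈ Icc (r₀ / 2) r₀, Q r ≠ 0 := fun r hr =>
    (h.pos r (Ioo_subset_Icc_self (hsub hr))).ne'
  have hr0 : ∀ r ∈ Icc (r₀ / 2) r₀, r ≠ 0 := fun r hr => (hsub hr).1.ne'
  have hβc : ContinuousOn (fun r => Q r ^ (-n) - n / c / Q r - n * (g r - m * (P r / r)) / Q r)
      (Icc (r₀ / 2) r₀) :=
    ((hQc.rpow_const fun r hr => Or.inl (hQ0 r hr)).sub (continuousOn_const.div hQc hQ0)).sub
      ((continuousOn_const.mul (hgc.sub (continuousOn_const.mul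
        (hPc.div continuousOn_id hr0)))).div hQc hQ0)
  obtain ⟨B, hB⟩ := isCompact_Icc.exists_bound_of_continuousOn hβc
  set C := 1 + B + 4 * m / r₀ with hC
  have hD : ∀ r ∈ Icc (r₀ / 2) r₀, HasDerivAt (fun s => exp (C * s) * (P s ^ 2 + g s ^ 2))
      (exp (C * r) * (C * (P r ^ 2 + g r ^ 2) + (2 * P r * (g r - m * (P r / r)) +
        2 * g r * (P r * (Q r ^ (-n) - n / c / Q r - n * (g r - m * (P r / r)) / Q r))))) r := by
    intro r hr
    refine ((((hasDerivAt_id r).const_mul C).exp).mul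
      (((h.hasDerivAt_snd r (hsub hr)).pow 2).add
        ((h.hasDerivAt_radialForce hn (hsub hr)).pow 2))).congr_deriv ?_
    simp only [id, hg, Pi.add_apply, Pi.pow_apply]
    ring
  have hmono : MonotoneOn (fun s => exp (C * s) * (P s ^ 2 + g s ^ 2)) (Icc (r₀ / 2) r₀) := by
    refine monotoneOn_of_deriv_nonneg (convex_Icc _ _)
      (fun r hr => (hD r hr).continuousAt.continuousWithinAt) ?_ ?_
    · exact fun r hr => (hD r (interior_subset hr)).differentiableAt.differentiableWithinAt
    · intro r hr
      have hr := interior_subset hr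
      rw [(hD r hr).deriv]
      have hb := hB r hr
      generalize Q r ^ (-n) - n / c / Q r - n * (g r - m * (P r / r)) / Q r = β at hb ⊢
      refine mul_nonneg (exp_pos _).le ?_
      have hmr : m * (P r ^ 2 / r) ≤ 2 * m / r₀ * P r ^ 2 := by
        have : P r ^ 2 / r ≤ P r ^ 2 / (r₀ / 2) :=
          div_le_div_of_nonneg_left (sq_nonneg _) (by linarith) hr.1
        calc m * (P r ^ 2 / r) ≤ m * (P r ^ 2 / (r₀ / 2)) := by gcongr
          _ = 2 * m / r₀ * P r ^ 2 := by field_simp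
      have hb' := abs_le.1 (norm_eq_abs β ▸ hb)
      have hmg : 0 ≤ 2 * m / r₀ * g r ^ 2 := by positivity
      have e1 : 2 * P r * (g r - m * (P r / r)) = 2 * P r * g r - 2 * (m * (P r ^ 2 / r)) := by
        ring
      have e2 : (4 * m / r₀ : ℝ) = 2 * (2 * m / r₀) := by ring
      rw [e1, hC, e2]
      nlinarith [sq_nonneg (P r + g r), mul_nonneg (sub_nonneg.2 hb'.2) (sq_nonneg (P r - g r)),
        mul_nonneg (neg_le_iff_add_nonneg.1 hb'.1) (sq_nonneg (P r + g r))]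
  have hle := hmono (left_mem_Icc.2 (by linarith)) (right_mem_Icc.2 (by linarith))
    (by linarith : r₀ / 2 ≤ r₀)
  have hzero : P r₀ ^ 2 + g r₀ ^ 2 = 0 := by
    rw [hP₀, show g r₀ = 0 from hg₀]
    norm_num
  simp only [hzero, mul_zero] at hle
  have hneg := hP (r₀ / 2) ⟨by linarith, by linarith⟩
  have : 0 < exp (C * (r₀ / 2)) * (P (r₀ / 2) ^ 2 + g (r₀ / 2) ^ 2) :=
    mul_pos (exp_pos _) (by nlinarith [sq_nonneg (g (r₀ / 2))])
  linarith

/-- Where `P` first returns to zero, it crosses zero transversally. -/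
theorem radialForce_pos (h : IsRadialSolution m n c μ σ Q P W) (hn : 1 < n) {r₀ : ℝ}
    (hr₀ : r₀ ∈ Ioo 0 σ) (hP : ∀ r ∈ Ioo 0 r₀, P r < 0) (hP₀ : P r₀ = 0) :
    0 < radialForce n c (Q r₀) (P r₀) (W r₀) := by
  refine lt_of_le_of_ne ?_ (h.radialForce_ne_zero hn hr₀ hP hP₀).symm
  have hd := h.hasDerivAt_snd r₀ hr₀
  rw [show (m:ℝ) * (P r₀ / r₀) = 0 by simp [hP₀], sub_zero] at hd
  have hs := (hasDerivAt_iff_tendsto_slope.1 hd).mono_left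
    (nhdsWithin_mono r₀ (s := Iio r₀) fun r (hr : r < r₀) => hr.ne)
  refine ge_of_tendsto hs ?_
  filter_upwards [Ioo_mem_nhdsLT hr₀.1] with r hr
  rw [slope_def_field, hP₀, sub_zero]
  exact div_nonneg_of_nonpos (hP r hr).le (by linarith [hr.2])

theorem eventually_snd_pos (h : IsRadialSolution m n c μ σ Q P W) (hn : 1 < n) {r₀ : ℝ}
    (hr₀ : r₀ ∈ Ioo 0 σ) (hP : ∀ r ∈ Ioo 0 r₀, P r < 0) (hP₀ : P r₀ = 0) :
    ∀ᶠ r in 𝓝[>] r₀, 0 < P r := by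
  have hd := h.hasDerivAt_snd r₀ hr₀
  rw [show (m:ℝ) * (P r₀ / r₀) = 0 by simp [hP₀], sub_zero] at hd
  have hs := ((hasDerivAt_iff_tendsto_slope.1 hd).mono_left
    (nhdsWithin_mono _ fun r (hr : r₀ < r) => hr.ne')).eventually_const_lt
      (h.radialForce_pos hn hr₀ hP hP₀)
  filter_upwards [hs, self_mem_nhdsWithin] with r hr (hr' : r₀ < r)
  rw [slope_def_field, hP₀, sub_zero] at hr
  exact (div_pos_iff_of_pos_right (sub_pos.2 hr')).1 hr

end IsRadialSolution

/-- A priori bounds for decreasing radial solutions which stay above `Qs`. -/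
theorem exists_bound_isRadialSolution (m : ℕ) {n Qs : ℝ} (c : ℝ) (hn : 1 < n) (hQs : 0 < Qs)
    (M : ℝ) : ∃ K > 0, ∀ μ ∈ Icc M 0, ∀ (σ : ℝ) (Q P W : ℝ → ℝ),
      IsRadialSolution m n c μ σ Q P W → (∀ r ∈ Ioo 0 σ, P r < 0) →
      (∀ r ∈ Icc 0 σ, Qs ≤ Q r) → ∀ r ∈ Icc 0 σ, Q r ≤ 1 ∧ |P r| ≤ K ∧ |W r| ≤ K := by
  set d : ℝ := m + 1 with hd
  have hsub : Icc Qs 1 ⊆ Ioi 0 := fun q hq => hQs.trans_le hq.1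
  obtain ⟨B₁, hB₁⟩ := isCompact_Icc.exists_bound_of_continuousOn
    ((continuousOn_F1 (d := d) (c := c) hn.ne' 0).mono hsub)
  obtain ⟨B₂, hB₂⟩ := isCompact_Icc.exists_bound_of_continuousOn
    ((continuousOn_F2 (d := d) (c := c) hn.ne' 0).mono hsub)
  obtain ⟨C₂, hC₂⟩ := isCompact_Icc.exists_bound_of_continuousOn
    ((continuousOn_F2 (d := d) (c := c) hn.ne' 1).mono hsub)
  obtain ⟨B₃, hB₃⟩ := isCompact_Icc.exists_bound_of_continuousOn
    ((continuousOn_F3 (d := d) (c := c) hn.ne' 0).mono hsub)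
  obtain ⟨C₃, hC₃⟩ := isCompact_Icc.exists_bound_of_continuousOn
    ((continuousOn_F3 (d := d) (c := c) hn.ne' 1).mono hsub)
  simp only [norm_eq_abs] at hB₁ hB₂ hC₂ hB₃ hC₃
  set E₂ := |B₂| + |M| * (|C₂| + |B₂|) with hE₂
  set E₃ := |B₃| + |M| * (|C₃| + |B₃|) + |B₁| with hE₃
  have hdpos : 0 < d := by positivity
  have hE₃0 : 0 ≤ E₃ := by positivity
  have hE₂0 : 0 ≤ E₂ := by positivity
  have hQn : 0 < Qs ^ n := rpow_pos_of_pos hQs n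
  refine ⟨1 + 2 * E₂ / Qs ^ n + |M| * d + E₃, by positivity, ?_⟩
  intro μ hμ σ Q P W h hP hQ r hr
  have hμM : |μ| ≤ |M| := by
    rw [abs_of_nonpos hμ.2, abs_of_nonpos (hμ.1.trans hμ.2)]
    linarith [hμ.1]
  have hMd : |μ| * d ≤ |M| * d := by gcongr
  have hQnn : 0 ≤ 2 * E₂ / Qs ^ n := by positivity
  rcases hr.1.eq_or_lt with rfl | h0
  · rw [h.fst_zero, h.snd_zero, h.thd_zero, abs_zero, abs_mul, ← hd, abs_of_pos hdpos]
    exact ⟨le_rfl, by positivity, by linarith⟩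
  have hr' : r ∈ Ioc 0 σ := ⟨h0, hr.2⟩
  have hQ1 := h.fst_lt_one hP r hr'
  have hq : Q r ∈ Icc Qs 1 := ⟨hQ r hr, hQ1.le⟩
  have hq0 := hQs.trans_le hq.1
  have haff : ∀ {a b B C : ℝ}, |a| ≤ B → |b| ≤ C → a + μ * (b - a) ≤ |B| + |M| * (|C| + |B|) := by
    intro a b B C ha hb
    have h1 : |μ * (b - a)| ≤ |M| * (|C| + |B|) := by
      rw [abs_mul]
      exact mul_le_mul hμM ((abs_sub b a).trans (add_le_add (hb.trans (le_abs_self _))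
        (ha.trans (le_abs_self _)))) (abs_nonneg _) (abs_nonneg _)
    linarith [le_abs_self (μ * (b - a)), le_abs_self a, le_abs_self B]
  refine ⟨hQ1.le, ?_, ?_⟩
  · have h1 := h.rpow_mul_sq_lt_F2 hn hd hP r hr'
    rw [F2_affine hn.ne' μ hq0] at h1
    have h2 := haff (hB₂ _ hq) (hC₂ _ hq)
    have h3 : Qs ^ n ≤ Q r ^ n := rpow_le_rpow hQs.le hq.1 (by linarith)
    have h4 : P r ^ 2 ≤ 2 * E₂ / Qs ^ n := by
      rw [le_div_iff₀ hQn]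
      nlinarith [sq_nonneg (P r)]
    have h5 : |P r| ≤ 1 + P r ^ 2 := by
      rw [← sq_abs]
      nlinarith [sq_nonneg (|P r| - 1), abs_nonneg (P r)]
    have : 0 ≤ |M| * d := by positivity
    linarith
  · have h1 := h.thd_lt_F3 hn hd hP r hr'
    have h2 := h.lt_thd (by linarith) hP r hr'
    rw [F3_affine hn.ne' μ hq0] at h1
    have h3 := haff (hB₃ _ hq) (hC₃ _ hq)
    have h4 := (abs_le.1 (hB₁ _ hq)).1
    have h5 := le_abs_self B₁
    have h6 : -(|μ| * d) ≤ μ * (m + 1) := by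
      rw [← hd, abs_of_nonpos hμ.2]
      linarith
    have : 0 ≤ |M| * d := by positivity
    rw [abs_le]
    constructor <;> linarith

theorem exists_isRadialSolution_of_mem_setA {m : ℕ} {d n c Qs μ : ℝ} (hn : 1 < n)
    (hd : d = m + 1) (h : μ ∈ setA d n c Qs) :
    ∃ (ρ : ℝ) (Q P W : ℝ → ℝ), 0 < ρ ∧ IsRadialSolution m n c μ ρ Q P W ∧
      (∀ r ∈ Ioc 0 ρ, P r < 0) ∧ Q ρ = Qs ∧ ∀ r ∈ Icc 0 ρ, Qs ≤ Q r := by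
  obtain ⟨hμ, Q, σ, ρ, hρ, hρσ, hsol, hpos, hQρ⟩ := h
  obtain ⟨W, hW⟩ := hsol.exists_isRadialSolution hn hd hμ.ne (hρ.trans hρσ) hρσ
    fun r hr => (hpos r hr).1
  have hP : ∀ r ∈ Ioc 0 ρ, deriv Q r < 0 := fun r hr => (hpos r ⟨hr.1, hr.2.trans hρσ.le⟩).2
  refine ⟨ρ, Q, deriv Q, W, hρ, hW, hP, hQρ, fun r hr => ?_⟩
  have hanti : StrictAntiOn Q (Icc 0 ρ) :=
    strictAntiOn_of_deriv_neg (convex_Icc 0 ρ) hW.continuousOn_fst fun r hr => by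
      rw [interior_Icc] at hr
      exact hP r (Ioo_subset_Ioc_self hr)
  rw [← hQρ]
  exact hanti.antitoneOn hr (right_mem_Icc.2 hρ.le) hr.2

theorem lt_mu2_of_mem_setA {m : ℕ} {d n c Qs μ q : ℝ} (hn : 1 < n) (hd : d = m + 1)
    (hQs : 0 < Qs) (h : μ ∈ setA d n c Qs) (hq : q ∈ Ioo Qs 1) : μ < mu2 d n c q := by
  obtain ⟨ρ, Q, P, W, hρ, hsol, hP, hQρ, -⟩ := exists_isRadialSolution_of_mem_setA hn hd h
  obtain ⟨r, hr, rfl⟩ := intermediate_value_Icc' hρ.le hsol.continuousOn_fst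
    (show q ∈ Icc (Q ρ) (Q 0) by rw [hQρ, hsol.fst_zero]; exact Ioo_subset_Icc_self hq)
  have hr0 : 0 < r := by
    refine lt_of_le_of_ne hr.1 fun e => ?_
    rw [← e, hsol.fst_zero] at hq
    exact lt_irrefl _ hq.2
  have hQ0 := hQs.trans hq.1
  refine lt_mu2_of_F2_pos hn (by rw [hd]; positivity) ⟨hQ0, hq.2⟩ ?_
  refine lt_of_le_of_lt ?_ (hsol.rpow_mul_sq_lt_F2 hn hd
    (fun s hs => hP s (Ioo_subset_Ioc_self hs)) r ⟨hr0, hr.2⟩)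
  positivity

/-- The initial state `(1, 0, μ d)` in dimension `d = m + 1`. -/
def initialState (m : ℕ) (μ : ℝ) : ℝ × ℝ × ℝ := (1, 0, μ * (m + 1))

/-- A global flow `Φ` of a cut-off `f` of the magma field, unchanged on a region `V` which
contains the trajectories started from `μ ∈ [M, 0]` as long as they decrease above `Qs`. -/
structure IsMagmaFlow (m : ℕ) (n c Qs M : ℝ) (V : Set (ℝ × ℝ × ℝ))
    (f : ℝ × ℝ × ℝ → ℝ × ℝ × ℝ) (Φ : ℝ × ℝ × ℝ → ℝ → ℝ × ℝ × ℝ) : Prop where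
  flow : IsRadialFlow m f Φ
  contDiff : ContDiff ℝ 2 f
  lipschitz : ∃ L, LipschitzWith L f
  isOpen : IsOpen V
  pos : ∀ x ∈ V, 0 < x.1
  eq_magmaField : ∀ x ∈ V, f x = magmaField n c x
  mem : ∀ μ ∈ Icc M 0, ∀ (σ : ℝ) (Q P W : ℝ → ℝ),
    IsRadialSolution m n c μ σ Q P W → (∀ r ∈ Ioo 0 σ, P r < 0) →
    (∀ r ∈ Icc 0 σ, Qs ≤ Q r) → ∀ r ∈ Icc 0 σ, (Q r, P r, W r) ∈ V

theorem exists_isMagmaFlow (m : ℕ) {n Qs : ℝ} (c : ℝ) (hn : 1 < n) (hQs : 0 < Qs) (M : ℝ) :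
    ∃ V f Φ, IsMagmaFlow m n c Qs M V f Φ := by
  obtain ⟨K, -, hK⟩ := exists_bound_isRadialSolution m c hn hQs M
  obtain ⟨f, hf, hsupp, hfeq⟩ := exists_contDiff_hasCompactSupport_eq
    (K := Icc (Qs / 2) 2 ×ˢ Icc (-(K + 1)) (K + 1) ×ˢ Icc (-(K + 1)) (K + 1))
    (isCompact_Icc.prod (isCompact_Icc.prod isCompact_Icc))
    (isOpen_lt continuous_const continuous_fst)
    (fun x hx => lt_of_lt_of_le (by positivity) hx.1.1) (contDiffOn_magmaField n c)
  obtain ⟨Φ, hΦ⟩ := exists_isRadialFlow m hf hsupp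
  refine ⟨Ioo (Qs / 2) 2 ×ˢ Ioo (-(K + 1)) (K + 1) ×ˢ Ioo (-(K + 1)) (K + 1), f, Φ, hΦ, hf,
    hf.lipschitzWith_of_hasCompactSupport hsupp two_ne_zero,
    isOpen_Ioo.prod (isOpen_Ioo.prod isOpen_Ioo), fun x hx => ?_, fun x hx => ?_, ?_⟩
  · exact lt_trans (by positivity) hx.1.1
  · exact hfeq x ⟨Ioo_subset_Icc_self hx.1, Ioo_subset_Icc_self hx.2.1,
      Ioo_subset_Icc_self hx.2.2⟩
  · intro μ hμ σ Q P W h hP hQ r hr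
    obtain ⟨h1, h2, h3⟩ := hK μ hμ σ Q P W h hP hQ r hr
    have h4 := hQ r hr
    rw [abs_le] at h2 h3
    exact ⟨⟨by simp only; linarith, by simp only; linarith⟩,
      ⟨by simp only; linarith, by simp only; linarith⟩,
      ⟨by simp only; linarith, by simp only; linarith⟩⟩

namespace IsMagmaFlow

variable {m : ℕ} {n c Qs M μ σ : ℝ} {V : Set (ℝ × ℝ × ℝ)}
  {f : ℝ × ℝ × ℝ → ℝ × ℝ × ℝ} {Φ : ℝ × ℝ × ℝ → ℝ → ℝ × ℝ × ℝ}

theorem initialState_mem (h : IsMagmaFlow m n c Qs M V f Φ) (hQs : Qs ≤ 1) (hμ : μ ∈ Icc M 0) :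
    initialState m μ ∈ V := by
  refine h.mem μ hμ 0 (fun _ => 1) (fun _ => 0) (fun _ => μ * (m + 1)) ?_ (by simp)
    (fun _ _ => hQs) 0 (by simp)
  refine ⟨continuousOn_const, continuousOn_const, continuousOn_const, rfl, rfl, rfl,
    fun _ _ => one_pos, ?_, ?_, ?_⟩ <;> simp

/-- The quotient `P / r` along the trajectory with parameter `μ`, continuous up to `r = 0`. -/
def quotient (m : ℕ) (f : ℝ × ℝ × ℝ → ℝ × ℝ × ℝ) (Φ : ℝ × ℝ × ℝ → ℝ → ℝ × ℝ × ℝ) (μ r : ℝ) : ℝ :=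
  radialMean m (fun s => (f (Φ (initialState m μ) s)).2.1) r

theorem snd_eq (h : IsMagmaFlow m n c Qs M V f Φ) (μ r : ℝ) :
    (Φ (initialState m μ) r).2.1 = r * quotient m f Φ μ r := by
  rw [h.flow.snd_eq, quotient]
  simp [initialState]

theorem continuous_state (h : IsMagmaFlow m n c Qs M V f Φ) :
    Continuous fun p : ℝ × ℝ => Φ (initialState m p.1) p.2 := by
  have : Continuous (initialState m) := by unfold initialState; fun_prop
  exact h.flow.continuous.comp ((this.comp continuous_fst).prodMk continuous_snd)

theorem continuous_quotient (h : IsMagmaFlow m n c Qs M V f Φ) :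
    Continuous fun p : ℝ × ℝ => quotient m f Φ p.1 p.2 := by
  refine continuous_radialMean_uncurry m (g := fun μ s => (f (Φ (initialState m μ) s)).2.1) ?_
  exact continuous_fst.comp (continuous_snd.comp (h.contDiff.continuous.comp h.continuous_state))

theorem continuous_state_apply (h : IsMagmaFlow m n c Qs M V f Φ) (μ : ℝ) :
    Continuous (Φ (initialState m μ)) := h.flow.continuous_apply _

theorem continuous_quotient_apply (h : IsMagmaFlow m n c Qs M V f Φ) (μ : ℝ) :
    Continuous (quotient m f Φ μ) :=
  h.continuous_quotient.comp (continuous_const.prodMk continuous_id)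

theorem radialForce_initialState (μ : ℝ) :
    (magmaField n c (initialState m μ)).2.1 = μ * (m + 1) := by
  simp [magmaField, radialForce, initialState, F1_one]

theorem quotient_zero (h : IsMagmaFlow m n c Qs M V f Φ) (hQs : Qs ≤ 1)
    (hμ : μ ∈ Icc M 0) : quotient m f Φ μ 0 = μ := by
  have : (m:ℝ) + 1 ≠ 0 := by positivity
  rw [quotient, radialMean_zero, h.flow.initial, h.eq_magmaField _ (h.initialState_mem hQs hμ),
    radialForce_initialState, mul_div_cancel_right₀ _ this]

theorem radialODE (h : IsMagmaFlow m n c Qs M V f Φ) (μ : ℝ) {r : ℝ} (hr : 0 < r) :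
    RadialODE m f (Φ (initialState m μ)) r := by
  refine ⟨h.flow.hasDerivAt_fst _ r, ?_, h.flow.hasDerivAt_thd _ r⟩
  rw [h.snd_eq, mul_div_cancel_left₀ _ hr.ne']
  exact h.flow.hasDerivAt_snd h.contDiff.continuous _ r

theorem isRadialSolution (h : IsMagmaFlow m n c Qs M V f Φ)
    (hV : ∀ r ∈ Ioo 0 σ, Φ (initialState m μ) r ∈ V)
    (hpos : ∀ r ∈ Icc 0 σ, 0 < (Φ (initialState m μ) r).1) :
    IsRadialSolution m n c μ σ (fun r => (Φ (initialState m μ) r).1)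
      (fun r => (Φ (initialState m μ) r).2.1) (fun r => (Φ (initialState m μ) r).2.2) := by
  have hc := h.continuous_state_apply μ
  have hode := fun r (hr : r ∈ Ioo 0 σ) => h.radialODE μ hr.1
  have hf := fun r hr => h.eq_magmaField _ (hV r hr)
  refine ⟨by fun_prop, by fun_prop, by fun_prop, ?_, ?_, ?_, hpos, fun r hr => ?_,
    fun r hr => ?_, fun r hr => ?_⟩
  · simp [h.flow.initial, initialState]
  · simp [h.flow.initial, initialState]
  · simp [h.flow.initial, initialState]
  · have := (hode r hr).1
    rwa [hf r hr] at this
  · have := (hode r hr).2.1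
    rwa [hf r hr] at this
  · have := (hode r hr).2.2
    rwa [hf r hr] at this

theorem isRadialSolution_of_mem (h : IsMagmaFlow m n c Qs M V f Φ)
    (hV : ∀ r ∈ Icc 0 σ, Φ (initialState m μ) r ∈ V) :
    IsRadialSolution m n c μ σ (fun r => (Φ (initialState m μ) r).1)
      (fun r => (Φ (initialState m μ) r).2.1) (fun r => (Φ (initialState m μ) r).2.2) :=
  h.isRadialSolution (fun r hr => hV r (Ioo_subset_Icc_self hr)) fun r hr => h.pos _ (hV r hr)

/-- A decreasing trajectory above `Qs` does not leave `V`. -/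
theorem state_mem (h : IsMagmaFlow m n c Qs M V f Φ) (hQs : 0 < Qs) (hμ : μ ∈ Icc M 0)
    (hP : ∀ r ∈ Ioo 0 σ, quotient m f Φ μ r < 0)
    (hQ : ∀ r ∈ Icc 0 σ, Qs ≤ (Φ (initialState m μ) r).1) :
    ∀ r ∈ Icc 0 σ, Φ (initialState m μ) r ∈ V := by
  by_contra! hne
  have hc := h.continuous_state_apply μ
  have hcl : IsCompact (Icc 0 σ ∩ {r | Φ (initialState m μ) r ∈ Vᶜ}) :=
    isCompact_Icc.inter_right (h.isOpen.isClosed_compl.preimage hc)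
  obtain ⟨ρ, ⟨hρ, hρV⟩, hmin⟩ := hcl.exists_isLeast hne
  have hsub : Icc 0 ρ ⊆ Icc 0 σ := Icc_subset_Icc_right hρ.2
  have hsol := h.isRadialSolution (μ := μ) (σ := ρ)
    (fun r hr => by
      by_contra hrV
      exact absurd (hmin ⟨⟨hr.1.le, hr.2.le.trans hρ.2⟩, hrV⟩) (not_le.2 hr.2))
    (fun r hr => hQs.trans_le (hQ r (hsub hr)))
  exact hρV (h.mem μ hμ ρ _ _ _ hsol
    (fun r hr => by
      rw [h.snd_eq]
      exact mul_neg_of_pos_of_neg hr.1 (hP r ⟨hr.1, hr.2.trans_le hρ.2⟩))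
    (fun r hr => hQ r (hsub hr)) ρ (right_mem_Icc.2 hρ.1))

theorem state_eq (h : IsMagmaFlow m n c Qs M V f Φ) {Q P W : ℝ → ℝ}
    (hsol : IsRadialSolution m n c μ σ Q P W) (hV : ∀ r ∈ Icc 0 σ, (Q r, P r, W r) ∈ V) :
    ∀ r ∈ Icc 0 σ, Φ (initialState m μ) r = (Q r, P r, W r) := by
  obtain ⟨L, hL⟩ := h.lipschitz
  refine RadialODE.eqOn (u := Φ (initialState m μ)) (v := fun r => (Q r, P r, W r)) hL
    (h.continuous_state_apply μ).continuousOn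
    (hsol.continuousOn_fst.prodMk (hsol.continuousOn_snd.prodMk hsol.continuousOn_thd))
    (fun r hr => h.radialODE μ hr.1) (fun r hr => ?_)
    (by simp [h.flow.initial, initialState, hsol.fst_zero, hsol.snd_zero, hsol.thd_zero])
  rw [RadialODE, h.eq_magmaField _ (hV r (Ioo_subset_Icc_self hr))]
  exact ⟨hsol.hasDerivAt_fst r hr, hsol.hasDerivAt_snd r hr, hsol.hasDerivAt_thd r hr⟩

theorem deriv_fst (h : IsMagmaFlow m n c Qs M V f Φ) {r : ℝ}
    (hV : Φ (initialState m μ) r ∈ V) :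
    deriv (fun s => (Φ (initialState m μ) s).1) r = (Φ (initialState m μ) r).2.1 := by
  rw [(h.flow.hasDerivAt_fst _ r).deriv, h.eq_magmaField _ hV]
  rfl

theorem contDiff_fst (h : IsMagmaFlow m n c Qs M V f Φ) (μ : ℝ) :
    ContDiff ℝ 3 fun s => (Φ (initialState m μ) s).1 := h.flow.contDiff_fst h.contDiff _

theorem fst_zero (h : IsMagmaFlow m n c Qs M V f Φ) (μ : ℝ) :
    (Φ (initialState m μ) 0).1 = 1 := by
  simp [h.flow.initial, initialState]

theorem deriv_fst_zero (h : IsMagmaFlow m n c Qs M V f Φ) (hQs : Qs ≤ 1) (hμ : μ ∈ Icc M 0) :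
    deriv (fun s => (Φ (initialState m μ) s).1) 0 = 0 := by
  rw [h.deriv_fst]
  · simp [h.flow.initial, initialState]
  · rw [h.flow.initial]
    exact h.initialState_mem hQs hμ

theorem deriv_deriv_fst_zero (h : IsMagmaFlow m n c Qs M V f Φ) (hQs : Qs ≤ 1)
    (hμ : μ ∈ Icc M 0) : deriv (deriv fun s => (Φ (initialState m μ) s).1) 0 = μ := by
  have hmem := h.initialState_mem hQs hμ
  have hev : deriv (fun s => (Φ (initialState m μ) s).1) =ᶠ[𝓝 0]
      fun s => (Φ (initialState m μ) s).2.1 := by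
    have : ∀ᶠ s in 𝓝 0, Φ (initialState m μ) s ∈ V :=
      (h.continuous_state_apply μ).continuousAt.eventually_mem
        (h.isOpen.mem_nhds (by rwa [h.flow.initial]))
    filter_upwards [this] with s hs using h.deriv_fst hs
  have hq := h.quotient_zero hQs hμ
  rw [quotient] at hq
  rw [hev.deriv_eq, (h.flow.hasDerivAt_snd h.contDiff.continuous _ 0).deriv, hq, h.flow.initial,
    h.eq_magmaField _ hmem, radialForce_initialState]
  ring

end IsMagmaFlow

/-- A strict condition on a compact interval is stable under perturbation of the parameter. -/
theorem eventually_forall_mem_Icc {X : Type*} [TopologicalSpace X] {O : Set (X × ℝ)}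
    (hO : IsOpen O) {x : X} {a b : ℝ} (h : ∀ r ∈ Icc a b, (x, r) ∈ O) :
    ∀ᶠ y in 𝓝 x, ∀ r ∈ Icc a b, (y, r) ∈ O :=
  isCompact_Icc.eventually_forall_of_forall_eventually fun r hr => hO.mem_nhds (h r hr)

/-- A continuous curve which stays in an open set on `[0, a]` does so a little longer. -/
theorem exists_gt_forall_mem_Icc {X : Type*} [TopologicalSpace X] {u : ℝ → X} (hu : Continuous u)
    {O : Set X} (hO : IsOpen O) {a : ℝ} (ha : 0 ≤ a) (h : ∀ r ∈ Icc 0 a, u r ∈ O) :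
    ∃ b > a, ∀ r ∈ Icc 0 b, u r ∈ O := by
  have hev : ∀ᶠ r in 𝓝 a, u r ∈ O := hu.continuousAt.eventually_mem
    (hO.mem_nhds (h a (right_mem_Icc.2 ha)))
  obtain ⟨ε, hε, hb⟩ := Metric.eventually_nhds_iff.1 hev
  refine ⟨a + ε / 2, by linarith, fun r hr => ?_⟩
  rcases le_total r a with hra | hra
  · exact h r ⟨hr.1, hra⟩
  · refine hb ?_
    rw [dist_eq, abs_of_nonneg (by linarith)]
    linarith [hr.2]

namespace IsMagmaFlow

variable {m : ℕ} {n c Qs M μ σ : ℝ} {V : Set (ℝ × ℝ × ℝ)}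
  {f : ℝ × ℝ × ℝ → ℝ × ℝ × ℝ} {Φ : ℝ × ℝ × ℝ → ℝ → ℝ × ℝ × ℝ}

/-- The trajectory with parameter `μ` decreases below `Qs`. -/
def Crosses (m : ℕ) (Qs : ℝ) (V : Set (ℝ × ℝ × ℝ)) (f : ℝ × ℝ × ℝ → ℝ × ℝ × ℝ)
    (Φ : ℝ × ℝ × ℝ → ℝ → ℝ × ℝ × ℝ) (μ : ℝ) : Prop :=
  ∃ σ > 0, (∀ r ∈ Icc 0 σ, Φ (initialState m μ) r ∈ V ∧ quotient m f Φ μ r < 0) ∧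
    (Φ (initialState m μ) σ).1 < Qs

/-- The trajectory with parameter `μ` turns around above `Qs`. -/
def Turns (m : ℕ) (Qs : ℝ) (f : ℝ × ℝ × ℝ → ℝ × ℝ × ℝ)
    (Φ : ℝ × ℝ × ℝ → ℝ → ℝ × ℝ × ℝ) (μ : ℝ) : Prop :=
  ∃ σ > 0, (∀ r ∈ Icc 0 σ, Qs < (Φ (initialState m μ) r).1) ∧ 0 < quotient m f Φ μ σ

theorem eventually_crosses (h : IsMagmaFlow m n c Qs M V f Φ) (hμ : Crosses m Qs V f Φ μ) :
    ∀ᶠ ν in 𝓝 μ, Crosses m Qs V f Φ ν := by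
  obtain ⟨σ, hσ, hr, hq⟩ := hμ
  have hO : IsOpen {p : ℝ × ℝ | Φ (initialState m p.1) p.2 ∈ V ∧ quotient m f Φ p.1 p.2 < 0} :=
    (h.isOpen.preimage h.continuous_state).inter
      (isOpen_lt h.continuous_quotient continuous_const)
  have hc : Continuous fun ν => (Φ (initialState m ν) σ).1 :=
    continuous_fst.comp (h.continuous_state.comp (continuous_id.prodMk continuous_const))
  filter_upwards [eventually_forall_mem_Icc hO hr, hc.continuousAt.eventually_lt_const hq]
    with ν h1 h2 using ⟨σ, hσ, h1, h2⟩

theorem eventually_turns (h : IsMagmaFlow m n c Qs M V f Φ) (hμ : Turns m Qs f Φ μ) :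
    ∀ᶠ ν in 𝓝 μ, Turns m Qs f Φ ν := by
  obtain ⟨σ, hσ, hr, hq⟩ := hμ
  have hO : IsOpen {p : ℝ × ℝ | Qs < (Φ (initialState m p.1) p.2).1} :=
    isOpen_lt continuous_const (continuous_fst.comp h.continuous_state)
  have hc : Continuous fun ν => quotient m f Φ ν σ :=
    h.continuous_quotient.comp (continuous_id.prodMk continuous_const)
  filter_upwards [eventually_forall_mem_Icc hO hr, hc.continuousAt.eventually_const_lt hq]
    with ν h1 h2 using ⟨σ, hσ, h1, h2⟩

theorem mem_setA_of_crosses {d : ℝ} (h : IsMagmaFlow m n c Qs M V f Φ) (hn : 1 < n)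
    (hd : d = m + 1) (hQs : Qs < 1) (hμ : μ ∈ Ico M 0) (hcr : Crosses m Qs V f Φ μ) :
    μ ∈ setA d n c Qs := by
  obtain ⟨σ, hσ, hr, hq⟩ := hcr
  have hμ' := Ico_subset_Icc_self hμ
  have hsol := h.isRadialSolution_of_mem fun r hr' => (hr r hr').1
  obtain ⟨ρ, hρ, hρQ⟩ := intermediate_value_Icc' hσ.le hsol.continuousOn_fst
    (show Qs ∈ Icc _ _ from ⟨hq.le, by simp only [h.fst_zero]; exact hQs.le⟩)
  have hρ0 : ρ ≠ 0 := by
    rintro rfl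
    simp only [h.fst_zero] at hρQ
    exact hQs.ne hρQ.symm
  have hρσ : ρ ≠ σ := by
    rintro rfl
    exact hq.ne hρQ
  refine ⟨hμ.2, _, σ, ρ, lt_of_le_of_ne hρ.1 hρ0.symm, lt_of_le_of_ne hρ.2 hρσ,
    ⟨(h.contDiff_fst μ).contDiffOn, fun r hr' => ?_, h.fst_zero μ, h.deriv_fst_zero hQs.le hμ',
      h.deriv_deriv_fst_zero hQs.le hμ'⟩, fun r hr' => ?_, hρQ⟩
  · exact hsol.magmaODE hn hd hr'
  · have hrI := Ioc_subset_Icc_self hr'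
    refine ⟨hsol.pos r hrI, ?_⟩
    rw [h.deriv_fst (hr r hrI).1, h.snd_eq]
    exact mul_neg_of_pos_of_neg hr'.1 (hr r hrI).2

theorem not_mem_setA_of_turns {d : ℝ} (h : IsMagmaFlow m n c Qs M V f Φ) (hn : 1 < n)
    (hd : d = m + 1) (hM : M ≤ μ) (ht : Turns m Qs f Φ μ) : μ ∉ setA d n c Qs := by
  intro hA
  obtain ⟨ρ, Q, P, W, hρ, hsol, hP, hQρ, hQ⟩ := exists_isRadialSolution_of_mem_setA hn hd hA
  obtain ⟨σ, hσ, hr, hq⟩ := ht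
  have heq := h.state_eq hsol (h.mem μ ⟨hM, hA.1.le⟩ ρ Q P W hsol
    (fun r hr => hP r (Ioo_subset_Ioc_self hr)) hQ)
  rcases le_or_gt ρ σ with hle | hlt
  · have h1 := hr ρ ⟨hρ.le, hle⟩
    rw [heq ρ (right_mem_Icc.2 hρ.le)] at h1
    exact h1.ne' hQρ
  · have h1 := h.snd_eq μ σ
    rw [heq σ ⟨hσ.le, hlt.le⟩] at h1
    have h2 := hP σ ⟨hσ, hlt.le⟩
    have h3 : P σ = σ * quotient m f Φ μ σ := h1
    rw [h3] at h2
    exact absurd h2 (not_lt.2 (mul_pos hσ hq).le)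

/-- A trajectory crosses `Qs`, or turns around above `Qs`, or decreases forever above `Qs`. -/
theorem crosses_or_turns_or_forall {d : ℝ} (h : IsMagmaFlow m n c Qs M V f Φ) (hn : 1 < n)
    (hd : d = m + 1) (hQs : Qs ∈ Ioo (0:ℝ) 1) (hμ : μ ∈ Ico M 0) (hF : F3 d n c Qs μ ≤ 0) :
    Crosses m Qs V f Φ μ ∨
      (Turns m Qs f Φ μ ∧ ∃ q ∈ Ioo Qs 1, 0 < F3 d n c q μ) ∨
      ∀ r ≥ 0, quotient m f Φ μ r < 0 ∧ Qs < (Φ (initialState m μ) r).1 := by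
  have hμ' := Ico_subset_Icc_self hμ
  have hc := h.continuous_state_apply μ
  have hqc := h.continuous_quotient_apply μ
  by_cases hglob : ∀ r ≥ 0, quotient m f Φ μ r < 0 ∧ Qs < (Φ (initialState m μ) r).1
  · exact Or.inr (Or.inr hglob)
  have hne : (Ici 0 ∩ {r | 0 ≤ quotient m f Φ μ r ∨ (Φ (initialState m μ) r).1 ≤ Qs}).Nonempty := by
    push Not at hglob
    obtain ⟨r, hr, hr'⟩ := hglob
    refine ⟨r, hr, ?_⟩
    rcases lt_or_ge (quotient m f Φ μ r) 0 with h1 | h1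
    · exact Or.inr (hr' h1)
    · exact Or.inl h1
  have hcl : IsClosed (Ici 0 ∩ {r | 0 ≤ quotient m f Φ μ r ∨ (Φ (initialState m μ) r).1 ≤ Qs}) :=
    isClosed_Ici.inter ((isClosed_le continuous_const hqc).union
      (isClosed_le (continuous_fst.comp hc) continuous_const))
  have hbdd : BddBelow
      (Ici 0 ∩ {r | 0 ≤ quotient m f Φ μ r ∨ (Φ (initialState m μ) r).1 ≤ Qs}) :=
    ⟨0, fun r hr => hr.1⟩
  obtain ⟨ρ, hρ⟩ : ∃ ρ, IsLeast _ ρ := ⟨_, hcl.isLeast_csInf hne hbdd⟩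
  obtain ⟨⟨hρ0, hρ1⟩, hmin⟩ := hρ
  have hbefore : ∀ r ∈ Ico 0 ρ, quotient m f Φ μ r < 0 ∧ Qs < (Φ (initialState m μ) r).1 := by
    intro r hr
    by_contra hcon
    rw [not_and_or, not_lt, not_lt] at hcon
    exact absurd (hmin ⟨hr.1, hcon⟩) (not_le.2 hr.2)
  have hρpos : 0 < ρ := by
    refine lt_of_le_of_ne hρ0 ?_
    rintro rfl
    rw [mem_ofPred_eq, h.quotient_zero hQs.2.le hμ', h.fst_zero] at hρ1
    rcases hρ1 with h1 | h1
    · exact absurd hμ.2 (not_lt.2 h1)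
    · exact absurd hQs.2 (not_lt.2 h1)
  have hlim : ∀ {u : ℝ → ℝ}, Continuous u → (∀ r ∈ Ico 0 ρ, 0 < u r) → 0 ≤ u ρ := by
    intro u hu hpos
    refine ge_of_tendsto (hu.continuousAt.tendsto.mono_left (nhdsWithin_le_nhds (s := Iio ρ))) ?_
    filter_upwards [Ioo_mem_nhdsLT hρpos] with r hr using (hpos r (Ioo_subset_Ico_self hr)).le
  have hqρ : quotient m f Φ μ ρ ≤ 0 := by
    have := hlim hqc.neg fun r hr => neg_pos.2 (hbefore r hr).1
    simpa using this
  have hQρ : Qs ≤ (Φ (initialState m μ) ρ).1 := by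
    have := hlim ((continuous_fst.comp hc).sub continuous_const)
      fun r hr => sub_pos.2 (hbefore r hr).2
    simpa using this
  have hQle : ∀ r ∈ Icc 0 ρ, Qs ≤ (Φ (initialState m μ) r).1 := fun r hr => by
    rcases hr.2.eq_or_lt with rfl | hlt
    · exact hQρ
    · exact (hbefore r ⟨hr.1, hlt⟩).2.le
  have hV := h.state_mem hQs.1 hμ' (fun r hr => (hbefore r (Ioo_subset_Ico_self hr)).1) hQle
  obtain ⟨b, hb, hVb⟩ := exists_gt_forall_mem_Icc hc h.isOpen hρ0 hV
  have hsol := h.isRadialSolution_of_mem hVb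
  have hsolρ := hsol.mono hb.le
  have hP : ∀ r ∈ Ioo 0 ρ, (Φ (initialState m μ) r).2.1 < 0 := fun r hr => by
    rw [h.snd_eq]
    exact mul_neg_of_pos_of_neg hr.1 (hbefore r (Ioo_subset_Ico_self hr)).1
  rcases hqρ.eq_or_lt with hzero | hneg
  · have hP0 : (Φ (initialState m μ) ρ).2.1 = 0 := by rw [h.snd_eq, hzero, mul_zero]
    have hFpos := (hsol.radialForce_pos hn ⟨hρpos, hb⟩ hP hP0).trans
      (hsolρ.radialForce_lt_F3 hn hd hP ⟨hρpos, le_rfl⟩)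
    have hQlt : Qs < (Φ (initialState m μ) ρ).1 := by
      refine lt_of_le_of_ne hQρ fun e => ?_
      simp only [← e] at hFpos
      exact absurd hFpos (not_lt.2 hF)
    refine Or.inr (Or.inl ⟨?_, _, ⟨hQlt, hsolρ.fst_lt_one hP ρ ⟨hρpos, le_rfl⟩⟩, hFpos⟩)
    obtain ⟨b', hb', hQb'⟩ := exists_gt_forall_mem_Icc (continuous_fst.comp hc)
      (isOpen_Ioi (a := Qs)) hρ0 fun r hr => by
        rcases hr.2.eq_or_lt with rfl | hlt
        · exact hQlt
        · exact (hbefore r ⟨hr.1, hlt⟩).2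
    obtain ⟨s, hsP, hs⟩ := ((hsol.eventually_snd_pos hn ⟨hρpos, hb⟩ hP hP0).and
      (Ioo_mem_nhdsGT hb')).exists
    have hs0 : 0 < s := hρpos.trans hs.1
    refine ⟨s, hs0, fun r hr => hQb' r ⟨hr.1, hr.2.trans hs.2.le⟩, ?_⟩
    rw [h.snd_eq] at hsP
    exact (pos_iff_pos_of_mul_pos hsP).1 hs0
  · have hQeq : (Φ (initialState m μ) ρ).1 = Qs := by
      rcases hρ1 with h1 | h1
      · exact absurd hneg (not_lt.2 h1)
      · exact le_antisymm h1 hQρ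
    obtain ⟨b', hb', hqb'⟩ := exists_gt_forall_mem_Icc hqc (isOpen_Iio (a := (0:ℝ))) hρ0
      fun r hr => by
        rcases hr.2.eq_or_lt with rfl | hlt
        · exact hneg
        · exact (hbefore r ⟨hr.1, hlt⟩).1
    set σ := min b b' with hσ
    have hρσ : ρ < σ := lt_min hb hb'
    have hσ0 : 0 < σ := hρpos.trans hρσ
    have hsolσ := hsol.mono (min_le_left b b')
    refine Or.inl ⟨σ, hσ0, fun r hr => ⟨hVb r ⟨hr.1, hr.2.trans (min_le_left _ _)⟩,
      hqb' r ⟨hr.1, hr.2.trans (min_le_right _ _)⟩⟩, ?_⟩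
    have hanti : StrictAntiOn (fun r => (Φ (initialState m μ) r).1) (Icc 0 σ) :=
      strictAntiOn_of_deriv_neg (convex_Icc 0 σ) hsolσ.continuousOn_fst fun r hr => by
        rw [interior_Icc] at hr
        rw [(hsolσ.hasDerivAt_fst r hr).deriv, h.snd_eq]
        exact mul_neg_of_pos_of_neg hr.1 (hqb' r ⟨hr.1.le, hr.2.le.trans (min_le_right _ _)⟩)
    rw [← hQeq]
    exact hanti ⟨hρ0, hρσ.le⟩ (right_mem_Icc.2 hσ0.le) hρσ

theorem state_mem_of_forall (h : IsMagmaFlow m n c Qs M V f Φ) (hQs : 0 < Qs) (hμ : μ ∈ Icc M 0)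
    (hglob : ∀ r ≥ 0, quotient m f Φ μ r < 0 ∧ Qs < (Φ (initialState m μ) r).1) :
    ∀ r ≥ 0, Φ (initialState m μ) r ∈ V := fun r hr =>
  h.state_mem hQs hμ (fun s hs => (hglob s hs.1.le).1) (fun s hs => (hglob s hs.1).2.le) r
    (right_mem_Icc.2 hr)

/-- Below the threshold given by `mu3`, a trajectory cannot decrease forever above `Qs`. -/
theorem not_forall_of_lt_mu3 {d ν κ : ℝ} (h : IsMagmaFlow m n c Qs M V f Φ) (hn : 1 < n)
    (hd : d = m + 1) (hQs : Qs ∈ Ioo (0:ℝ) 1) (hμ : μ ∈ Icc M 0) (hκ : 0 < κ)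
    (hslope : ∀ q ∈ Icc Qs 1, κ * (q - Qs) ≤ F3 d n c q 1 - F3 d n c q 0)
    (hν : ∀ q ∈ Ioo Qs 1, ν ≤ mu3 d n c q) (hμν : μ < ν) :
    ¬ ∀ r ≥ 0, quotient m f Φ μ r < 0 ∧ Qs < (Φ (initialState m μ) r).1 := by
  intro hglob
  have hV := h.state_mem_of_forall hQs.1 hμ hglob
  have hc := h.continuous_state_apply μ
  have hsol : ∀ σ, _ := fun σ => h.isRadialSolution_of_mem (σ := σ) fun r hr => hV r hr.1
  have hP : ∀ r > 0, (Φ (initialState m μ) r).2.1 < 0 := fun r hr => by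
    rw [h.snd_eq]
    exact mul_neg_of_pos_of_neg hr (hglob r hr.le).1
  refine false_of_radial_force_le (m := m) (v := fun r => (Φ (initialState m μ) r).1 - Qs)
    (P := fun r => (Φ (initialState m μ) r).2.1)
    (g := fun r => radialForce n c (Φ (initialState m μ) r).1 (Φ (initialState m μ) r).2.1
      (Φ (initialState m μ) r).2.2) (κ := (ν - μ) * κ) (mul_pos (sub_pos.2 hμν) hκ)
    (by fun_prop) (by fun_prop) (hsol 0).snd_zero
    (fun r hr => ((hsol (r + 1)).hasDerivAt_fst r ⟨hr, by linarith⟩).sub_const _)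
    (fun r hr => (hsol (r + 1)).hasDerivAt_snd r ⟨hr, by linarith⟩)
    (fun r hr => sub_pos.2 (hglob r hr.le).2) hP fun r hr => ?_
  have hq : (Φ (initialState m μ) r).1 ∈ Ioo Qs 1 := ⟨(hglob r hr.le).2,
    (hsol r).fst_lt_one (fun s hs => hP s hs.1) r ⟨hr, le_rfl⟩⟩
  have hpos : ∀ q ∈ Ioo Qs 1, 0 < F3 d n c q 1 - F3 d n c q 0 := fun q hq =>
    (mul_pos hκ (sub_pos.2 hq.1)).trans_le (hslope q (Ioo_subset_Icc_self hq))
  have h1 := (hsol r).radialForce_lt_F3 hn hd (fun s hs => hP s hs.1) (r := r) ⟨hr, le_rfl⟩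
  have h2 := F3_le_of_le_mu3 hn hQs.1 hpos hν μ hq
  have h3 := mul_le_mul_of_nonneg_right (hslope _ (Ioo_subset_Icc_self hq)) (sub_pos.2 hμν).le
  linarith

theorem isIVPSolution_of_forall {d : ℝ} (h : IsMagmaFlow m n c Qs M V f Φ) (hn : 1 < n)
    (hd : d = m + 1) (hQs : Qs ∈ Ioo (0:ℝ) 1) (hμ : μ ∈ Icc M 0)
    (hglob : ∀ r ≥ 0, quotient m f Φ μ r < 0 ∧ Qs < (Φ (initialState m μ) r).1) :
    ∃ Q : ℝ → ℝ, isIVPSolution d n c μ Q ∧ (∀ r : ℝ, 0 < r → 0 < Q r ∧ deriv Q r < 0) ∧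
      ∃ L : ℝ, Tendsto Q atTop (𝓝 L) ∧ Qs ≤ L := by
  have hV := h.state_mem_of_forall hQs.1 hμ hglob
  have hneg : ∀ r > 0, deriv (fun s => (Φ (initialState m μ) s).1) r < 0 := fun r hr => by
    rw [h.deriv_fst (hV r hr.le), h.snd_eq]
    exact mul_neg_of_pos_of_neg hr (hglob r hr.le).1
  have hanti : AntitoneOn (fun s => (Φ (initialState m μ) s).1) (Ici 0) :=
    (strictAntiOn_of_deriv_neg (convex_Ici 0) (h.contDiff_fst μ).continuous.continuousOn
      fun r hr => hneg r (by rwa [interior_Ici] at hr)).antitoneOn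
  refine ⟨fun s => (Φ (initialState m μ) s).1, ⟨(h.contDiff_fst μ).contDiffOn, fun r hr => ?_,
    h.fst_zero μ, h.deriv_fst_zero hQs.2.le hμ, h.deriv_deriv_fst_zero hQs.2.le hμ⟩,
    fun r hr => ⟨h.pos _ (hV r hr.le), hneg r hr⟩, ?_⟩
  · exact (h.isRadialSolution_of_mem (σ := r + 1) fun s hs => hV s hs.1).magmaODE hn hd
      ⟨hr, by linarith⟩
  · have hanti' : Antitone fun r => (Φ (initialState m μ) (max r 0)).1 := fun a b hab =>
      hanti (le_max_right a 0) (le_max_right b 0) (max_le_max_right 0 hab)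
    have hbdd : ∀ r, Qs ≤ (Φ (initialState m μ) (max r 0)).1 := fun r =>
      (hglob _ (le_max_right r 0)).2.le
    have hlim := tendsto_atTop_ciInf hanti' ⟨Qs, forall_mem_range.2 hbdd⟩
    refine ⟨_, hlim.congr' ?_, le_ciInf hbdd⟩
    filter_upwards [eventually_ge_atTop 0] with r hr
    rw [max_eq_left hr]

end IsMagmaFlow

theorem mem_setA_of_lt_mu3 {m : ℕ} {d n c Qs ν κ μ : ℝ} (hn : 1 < n) (hd : d = m + 1)
    (hQs : Qs ∈ Ioo (0:ℝ) 1) (hκ : 0 < κ)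
    (hslope : ∀ q ∈ Icc Qs 1, κ * (q - Qs) ≤ F3 d n c q 1 - F3 d n c q 0)
    (hν : ∀ q ∈ Ioo Qs 1, ν ≤ mu3 d n c q) (hF : F3 d n c Qs μ ≤ 0) (hμν : μ < ν)
    (hμ : μ < 0) : μ ∈ setA d n c Qs := by
  obtain ⟨V, f, Φ, h⟩ := exists_isMagmaFlow m c hn hQs.1 μ
  have hμI : μ ∈ Ico μ 0 := ⟨le_rfl, hμ⟩
  have hpos : ∀ q ∈ Ioo Qs 1, 0 < F3 d n c q 1 - F3 d n c q 0 := fun q hq =>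
    (mul_pos hκ (sub_pos.2 hq.1)).trans_le (hslope q (Ioo_subset_Icc_self hq))
  rcases h.crosses_or_turns_or_forall hn hd hQs hμI hF with hcr | ⟨-, q, hq, hFq⟩ | hglob
  · exact h.mem_setA_of_crosses hn hd hQs.2 hμI hcr
  · have h1 := F3_le_of_le_mu3 hn hQs.1 hpos hν μ hq
    have h2 := mul_neg_of_pos_of_neg (hpos q hq) (sub_neg.2 hμν)
    linarith
  · exact absurd hglob (h.not_forall_of_lt_mu3 hn hd hQs (Ico_subset_Icc_self hμI) hκ hslope hν
      hμν)

/-- The critical shooting parameter μ_c = sup A lies in [μ₃(Q₃), μ₂(Q₂)], and the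
corresponding solution is globally defined, positive, strictly decreasing, with limit ≥ Q_*
(Lemma "existence", proving the main solitary-wave proposition). -/
theorem magma_critical_mu_solution
    (d : ℕ) (hd : 1 ≤ d) (n c Qs Q2 Q3 : ℝ)
    (hn : n ∈ Icc (2:ℝ) 3) (hc : c ∈ Ico (1.55:ℝ) n)
    (hQs : Qs ∈ Ioo (0:ℝ) 1) (hQsz : F3 (d:ℝ) n c Qs 1 - F3 (d:ℝ) n c Qs 0 = 0)
    (hQsu : ∀ q ∈ Ioo (0:ℝ) 1, F3 (d:ℝ) n c q 1 - F3 (d:ℝ) n c q 0 = 0 → q = Qs)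
    (hQ2 : Q2 ∈ Ioo Qs 1)
    (hQ2min : ∀ Q ∈ Ioo Qs (1:ℝ), mu2 (d:ℝ) n c Q2 ≤ mu2 (d:ℝ) n c Q)
    (hQ2uniq : ∀ Q ∈ Ioo Qs (1:ℝ), mu2 (d:ℝ) n c Q = mu2 (d:ℝ) n c Q2 → Q = Q2)
    (hQ3 : Q3 ∈ Ioo Qs 1)
    (hQ3min : ∀ Q ∈ Ioo Qs (1:ℝ), mu3 (d:ℝ) n c Q3 ≤ mu3 (d:ℝ) n c Q)
    (hQ3uniq : ∀ Q ∈ Ioo Qs (1:ℝ), mu3 (d:ℝ) n c Q = mu3 (d:ℝ) n c Q3 → Q = Q3) :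
    mu3 (d:ℝ) n c Q3 ≤ sSup (setA (d:ℝ) n c Qs) ∧
    sSup (setA (d:ℝ) n c Qs) ≤ mu2 (d:ℝ) n c Q2 ∧
    sSup (setA (d:ℝ) n c Qs) < 0 ∧
    ∃ Q : ℝ → ℝ, isIVPSolution (d:ℝ) n c (sSup (setA (d:ℝ) n c Qs)) Q ∧
      (∀ r : ℝ, 0 < r → 0 < Q r ∧ deriv Q r < 0) ∧
      ∃ L : ℝ, Tendsto Q atTop (𝓝 L) ∧ Qs ≤ L := by
  have hn1 : 1 < n := by linarith [hn.1]
  have hc0 : 0 < c := by linarith [hc.1]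
  obtain ⟨m, rfl⟩ : ∃ m, d = m + 1 := ⟨d - 1, by omega⟩
  have hdm : ((m + 1 : ℕ) : ℝ) = m + 1 := by push_cast; ring
  generalize ((m + 1 : ℕ) : ℝ) = D at *
  have hD : 0 < D := by rw [hdm]; positivity
  obtain ⟨κ, hκ, hslope⟩ := exists_le_F3_slope hn1 hD hQs hQsz hQsu
  have hpos : ∀ q ∈ Ioo Qs 1, 0 < F3 D n c q 1 - F3 D n c q 0 := fun q hq =>
    (mul_pos hκ (sub_pos.2 hq.1)).trans_le (hslope q (Ioo_subset_Icc_self hq))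
  have hF := F3_nonpos_of_le_mu3 hn1 hQs hQsz hpos hQ3min
  have hmu2 : mu2 D n c Q2 < 0 := by
    obtain ⟨q, hq, hneg⟩ := exists_mu2_neg (d := D) hn1 hD hc0 hc.2 hQs
    exact (hQ2min q hq).trans_lt hneg
  have hmem : ∀ μ < 0, μ < mu3 D n c Q3 → μ ∈ setA D n c Qs := fun μ h0 h3 =>
    mem_setA_of_lt_mu3 hn1 hdm hQs hκ hslope hQ3min (hF μ) h3 h0
  have hub : ∀ μ ∈ setA D n c Qs, μ ≤ mu2 D n c Q2 := fun μ hμ =>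
    (lt_mu2_of_mem_setA hn1 hdm hQs.1 hμ hQ2).le
  have hbdd : BddAbove (setA D n c Qs) := ⟨_, hub⟩
  have hne : (setA D n c Qs).Nonempty := by
    obtain ⟨μ, hμ⟩ := exists_lt (min 0 (mu3 D n c Q3))
    exact ⟨μ, hmem μ (hμ.trans_le (min_le_left _ _)) (hμ.trans_le (min_le_right _ _))⟩
  have hle2 : sSup (setA D n c Qs) ≤ mu2 D n c Q2 := csSup_le hne hub
  have hneg := hle2.trans_lt hmu2
  set μc := sSup (setA D n c Qs) with hμc
  have hle3 : mu3 D n c Q3 ≤ μc := by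
    by_contra! hlt
    obtain ⟨μ, h1, h2⟩ := exists_between (lt_min hneg hlt)
    exact absurd (le_csSup hbdd (hmem μ (h2.trans_le (min_le_left _ _))
      (h2.trans_le (min_le_right _ _)))) (not_le.2 h1)
  refine ⟨hle3, hle2, hneg, ?_⟩
  obtain ⟨V, f, Φ, h⟩ := exists_isMagmaFlow m c hn1 hQs.1 (μc - 1)
  have hμI : μc ∈ Ico (μc - 1) 0 := ⟨by linarith, hneg⟩
  rcases h.crosses_or_turns_or_forall hn1 hdm hQs hμI (hF μc) with hcr | ⟨ht, -⟩ | hglob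
  · obtain ⟨μ, hμcr, hμ⟩ := (((h.eventually_crosses hcr).filter_mono
      (nhdsWithin_le_nhds (s := Ioi μc))).and (Ioo_mem_nhdsGT hneg)).exists
    exact absurd (le_csSup hbdd (h.mem_setA_of_crosses hn1 hdm hQs.2
      ⟨by linarith [hμ.1], hμ.2⟩ hμcr)) (not_le.2 hμ.1)
  · obtain ⟨ε, hε, hball⟩ := Metric.eventually_nhds_iff.1 (h.eventually_turns ht)
    obtain ⟨μ, hμA, hμ⟩ := exists_lt_of_lt_csSup hne
      (show max (μc - 1) (μc - ε) < μc from max_lt (by linarith) (by linarith))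
    have h1 := (le_max_left _ _).trans_lt hμ
    have h2 := (le_max_right _ _).trans_lt hμ
    have h3 := le_csSup hbdd hμA
    refine absurd hμA (h.not_mem_setA_of_turns hn1 hdm h1.le (hball ?_))
    rw [dist_eq, abs_lt]
    constructor <;> linarith
  · exact h.isIVPSolution_of_forall hn1 hdm hQs (Ico_subset_Icc_self hμI) hglob
end
end

section
/- Let d ∈ ℕ with d ≥ 1, n ∈ [2,3], c ∈ [1.55, n), μ < 0, and let Q ∈ C³([0,∞)) be a solution of the IVP with Q(r) > 0 and Q_r(r) < 0 for all r ∈ (0,∞), such that Q_τ := lim_{r→∞} Q(r) exists and Q_τ > 0. Then lim_{r→∞} Q_r(r) = 0 and lim_{r→∞} Q_rr(r) = 0. -/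
open Set Filter Topology intervalIntegral Real

noncomputable section

/-- Comparison principle for the radial operator `f' + m f / r`: a lower bound on it yields a
linear lower bound on `f`. -/
theorem eventually_linear_le_of_le_radial {f f' : ℝ → ℝ} {m : ℕ} {k k' : ℝ}
    (hf : ∀ r, 0 < r → HasDerivAt f (f' r) r)
    (hk : ∀ᶠ r in atTop, k ≤ f' r + m * (f r / r)) (hk' : k' < k) :
    ∀ᶠ r in atTop, k' / (m + 1) * r ≤ f r := by
  obtain ⟨R₀, hR₀⟩ := eventually_atTop.1 hk
  set R := max R₀ 1 with hR
  have hR1 : 1 ≤ R := le_max_right _ _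
  have hm : (0:ℝ) < m + 1 := by positivity
  have hderiv : ∀ r, 0 < r → HasDerivAt (fun s => s ^ m * f s - k / (m + 1) * s ^ (m + 1))
      (r ^ m * (f' r + m * (f r / r) - k)) r := by
    intro r hr
    have h := ((hasDerivAt_pow m r).mul (hf r hr)).sub
      ((hasDerivAt_pow (m + 1) r).const_mul (k / (m + 1)))
    refine h.congr_deriv ?_
    rcases m with _ | m
    · simp
    · push_cast at hm ⊢
      field_simp
      ring
  have hmono : MonotoneOn (fun s => s ^ m * f s - k / (m + 1) * s ^ (m + 1)) (Ici R) := by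
    refine monotoneOn_of_deriv_nonneg (convex_Ici R) ?_ ?_ ?_
    · exact fun r hr => (hderiv r (by linarith [mem_Ici.1 hr])).continuousAt.continuousWithinAt
    · intro r hr
      rw [interior_Ici] at hr
      exact (hderiv r (by linarith [mem_Ioi.1 hr])).differentiableAt.differentiableWithinAt
    · intro r hr
      rw [interior_Ici] at hr
      have hr0 : 0 < r := by linarith [mem_Ioi.1 hr]
      rw [(hderiv r hr0).deriv]
      have := hR₀ r ((le_max_left _ _).trans (le_of_lt hr))
      exact mul_nonneg (by positivity) (by linarith)
  set C := R ^ m * f R - k / (m + 1) * R ^ (m + 1)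
  have hgap : 0 < (k - k') / (m + 1) := div_pos (by linarith) hm
  filter_upwards [eventually_ge_atTop R,
    (tendsto_id.const_mul_atTop hgap).eventually_ge_atTop (|C|)] with r hr hrC
  have hr1 : 1 ≤ r := hR1.trans hr
  have hC : C ≤ r ^ m * f r - k / (m + 1) * r ^ (m + 1) :=
    hmono (mem_Ici.2 le_rfl) (mem_Ici.2 hr) hr
  have hp : 1 ≤ r ^ m := one_le_pow₀ hr1
  have hbig : |C| ≤ r ^ m * ((k - k') / (m + 1) * r) :=
    hrC.trans (le_mul_of_one_le_left (by positivity) hp)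
  have hsplit : r ^ m * ((k - k') / (m + 1) * r)
      = k / (m + 1) * r ^ (m + 1) - r ^ m * (k' / (m + 1) * r) := by ring
  refine le_of_mul_le_mul_left (?_ : r ^ m * _ ≤ r ^ m * _) (by positivity)
  linarith [neg_abs_le C]

/-- Upper counterpart of `eventually_linear_le_of_le_radial`. -/
theorem eventually_le_linear_of_radial_le {f f' : ℝ → ℝ} {m : ℕ} {k k' : ℝ}
    (hf : ∀ r, 0 < r → HasDerivAt f (f' r) r)
    (hk : ∀ᶠ r in atTop, f' r + m * (f r / r) ≤ k) (hk' : k < k') :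
    ∀ᶠ r in atTop, f r ≤ k' / (m + 1) * r := by
  have h := eventually_linear_le_of_le_radial (f := fun r => -f r) (f' := fun r => -f' r)
    (m := m) (k := -k) (k' := -k') (fun r hr => (hf r hr).neg)
    (hk.mono fun r hr => by rw [neg_div]; linarith) (by linarith)
  filter_upwards [h] with r hr
  rw [neg_div] at hr
  linarith

/-- If `f' + m f / r → 0` then `f / r → 0`. -/
theorem tendsto_div_self_of_radial_tendsto_zero {f f' : ℝ → ℝ} {m : ℕ}
    (hf : ∀ r, 0 < r → HasDerivAt f (f' r) r)
    (h : Tendsto (fun r => f' r + m * (f r / r)) atTop (𝓝 0)) :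
    Tendsto (fun r => f r / r) atTop (𝓝 0) := by
  have hm : (0:ℝ) < m + 1 := by positivity
  refine tendsto_order.2 ⟨fun a ha => ?_, fun a ha => ?_⟩
  · have := eventually_linear_le_of_le_radial (k := a * (m + 1) / 4) (k' := a * (m + 1) / 2) hf
      ((h.eventually_const_lt (by nlinarith)).mono fun _ => le_of_lt) (by nlinarith)
    filter_upwards [this, eventually_gt_atTop 0] with r hr hr0
    rw [lt_div_iff₀ hr0]
    have : a * (m + 1) / 2 / (m + 1) = a / 2 := by field_simp
    rw [this] at hr
    nlinarith
  · have := eventually_le_linear_of_radial_le (k := a * (m + 1) / 4) (k' := a * (m + 1) / 2) hf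
      ((h.eventually_lt_const (by nlinarith)).mono fun _ => le_of_lt) (by nlinarith)
    filter_upwards [this, eventually_gt_atTop 0] with r hr hr0
    rw [div_lt_iff₀ hr0]
    have : a * (m + 1) / 2 / (m + 1) = a / 2 := by field_simp
    rw [this] at hr
    nlinarith

/-- A function whose derivative is eventually below a negative constant has no limit at
infinity. -/
theorem not_tendsto_nhds_of_deriv_le_neg {g g' : ℝ → ℝ} {δ l : ℝ} (hδ : 0 < δ)
    (hg : ∀ r, 0 < r → HasDerivAt g (g' r) r) (h : ∀ᶠ r in atTop, g' r ≤ -δ) :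
    ¬ Tendsto g atTop (𝓝 l) := by
  intro hl
  have hlin := eventually_le_linear_of_radial_le (m := 0) (k := -δ) (k' := -(δ / 2)) hg
    (h.mono fun r hr => by simpa using hr) (by linarith)
  have hbot : Tendsto (fun r : ℝ => -(δ / 2) * r) atTop atBot :=
    tendsto_id.const_mul_atTop_of_neg (by linarith)
  refine not_tendsto_nhds_of_tendsto_atBot (tendsto_atBot_mono' _ ?_ hbot) l hl
  filter_upwards [hlin] with r hr
  simpa using hr

/-- A function with a finite limit and vanishing second derivative at infinity has vanishing
first derivative at infinity. -/
theorem tendsto_deriv_zero_of_tendsto_of_second_deriv {g g' g'' : ℝ → ℝ} {l : ℝ}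
    (hg : ∀ r, 0 < r → HasDerivAt g (g' r) r) (hg' : ∀ r, 0 < r → HasDerivAt g' (g'' r) r)
    (hl : Tendsto g atTop (𝓝 l)) (h : Tendsto g'' atTop (𝓝 0)) :
    Tendsto g' atTop (𝓝 0) := by
  rw [Metric.tendsto_nhds]
  intro ε hε
  have hdiff : Tendsto (fun r => g (r + 1) - g r) atTop (𝓝 0) := by
    simpa using (hl.comp (tendsto_atTop_add_const_right _ 1 tendsto_id)).sub hl
  obtain ⟨R, hR⟩ := eventually_atTop.1 (Metric.tendsto_nhds.1 h (ε / 2) (by linarith))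
  filter_upwards [Metric.tendsto_nhds.1 hdiff (ε / 2) (by linarith), eventually_ge_atTop R,
    eventually_gt_atTop 0] with r hrd hrR hr0
  simp only [Real.dist_eq, sub_zero] at hR hrd ⊢
  obtain ⟨ξ, hξ, hξeq⟩ := exists_hasDerivAt_eq_slope g g' (lt_add_one r)
    (fun x hx => (hg x (by linarith [hx.1])).continuousAt.continuousWithinAt)
    (fun x hx => hg x (by linarith [hx.1]))
  obtain ⟨η, hη, hηeq⟩ := exists_hasDerivAt_eq_slope g' g'' hξ.1
    (fun x hx => (hg' x (by linarith [hx.1])).continuousAt.continuousWithinAt)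
    (fun x hx => hg' x (by linarith [hx.1]))
  have hlen : 0 < ξ - r := by linarith [hξ.1]
  rw [eq_div_iff hlen.ne'] at hηeq
  rw [add_sub_cancel_left, div_one] at hξeq
  have hη' := hR η (by linarith [hη.1])
  have hsmall : |g' ξ - g' r| ≤ ε / 2 := by
    rw [← hηeq, abs_mul, abs_of_pos hlen]
    nlinarith [hξ.2, abs_nonneg (g'' η)]
  have := abs_sub_abs_le_abs_sub (g' r) (g' ξ)
  rw [abs_sub_comm] at this
  rw [hξeq] at this hsmall
  linarith

/-- Along a solution, `Qⁿ ΔQ - Q + Qⁿ / c` has derivative `(d - 1) n Qⁿ⁻¹ Q_r² / r`. -/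
theorem magmaODE.hasDerivAt_flux {d n c r : ℝ} {Q : ℝ → ℝ} (hr : 0 < r) (hpos : 0 < Q r)
    (hQ : DifferentiableAt ℝ Q r) (hQ' : DifferentiableAt ℝ (deriv Q) r)
    (hQ'' : DifferentiableAt ℝ (deriv (deriv Q)) r) (h : magmaODE d n c Q r) :
    HasDerivAt
      (fun s => Q s ^ n * (deriv (deriv Q) s + (d - 1) * (deriv Q s / s)) - Q s + Q s ^ n / c)
      ((d - 1) * n * Q r ^ (n - 1) * deriv Q r ^ 2 / r) r := by
  have hpow : HasDerivAt (fun s => Q s ^ n) (deriv Q r * n * Q r ^ (n - 1)) r :=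
    hQ.hasDerivAt.rpow_const (Or.inl hpos.ne')
  have hquot : DifferentiableAt ℝ (fun s => deriv Q s / s) r := hQ'.div differentiableAt_id hr.ne'
  have hprod := hpow.mul hQ''.hasDerivAt
  have hflux := ((hprod.add ((hpow.mul hquot.hasDerivAt).const_mul (d - 1))).sub
    hQ.hasDerivAt).add (hpow.div_const c)
  unfold magmaODE at h
  rw [hpow.deriv, show deriv (fun s => Q s ^ n * deriv (deriv Q) s) r = _ from hprod.deriv] at h
  refine (hflux.congr_of_eventuallyEq (.of_forall fun s => ?_)).congr_deriv ?_
  · simp only [Pi.add_apply, Pi.sub_apply, Pi.mul_apply]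
    ring
  · simp only [div_eq_mul_inv] at h ⊢
    linear_combination h

/-- A function with nonnegative derivative on `(0, ∞)` tends to infinity or to a finite limit. -/
theorem tendsto_atTop_or_nhds_of_deriv_nonneg {H H' : ℝ → ℝ}
    (hH : ∀ r, 0 < r → HasDerivAt H (H' r) r) (hH' : ∀ r, 0 < r → 0 ≤ H' r) :
    Tendsto H atTop atTop ∨ ∃ l, Tendsto H atTop (𝓝 l) := by
  have hmono : MonotoneOn H (Ici 1) := by
    refine monotoneOn_of_deriv_nonneg (convex_Ici 1) ?_ ?_ ?_
    · exact fun r hr => (hH r (by linarith [mem_Ici.1 hr])).continuousAt.continuousWithinAt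
    · intro r hr
      rw [interior_Ici] at hr
      exact (hH r (by linarith [mem_Ioi.1 hr])).differentiableAt.differentiableWithinAt
    · intro r hr
      rw [interior_Ici] at hr
      have hr0 : 0 < r := by linarith [mem_Ioi.1 hr]
      exact (hH r hr0).deriv ▸ hH' r hr0
  have hmax : Monotone fun r => H (max r 1) := fun a b hab =>
    hmono (mem_Ici.2 (le_max_right _ _)) (mem_Ici.2 (le_max_right _ _)) (max_le_max_right 1 hab)
  have heq : (fun r => H (max r 1)) =ᶠ[atTop] H := by
    filter_upwards [eventually_ge_atTop 1] with r hr
    rw [max_eq_left hr]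
  exact (tendsto_atTop_of_monotone hmax).imp (fun h => h.congr' heq)
    fun ⟨l, h⟩ => ⟨l, h.congr' heq⟩

/-- If a monotone positive global solution converges to a positive limit, then its first and
second derivatives tend to zero at infinity (Lemma on Q_r). -/
theorem magma_derivatives_tendsto_zero
    (d : ℕ) (hd : 1 ≤ d) (n c μ Qτ : ℝ)
    (hn : n ∈ Icc (2:ℝ) 3) (hc : c ∈ Ico (1.55:ℝ) n) (hμ : μ < 0)
    (Q : ℝ → ℝ) (hQ : isIVPSolution (d:ℝ) n c μ Q)
    (hpos : ∀ r : ℝ, 0 < r → 0 < Q r) (hdec : ∀ r : ℝ, 0 < r → deriv Q r < 0)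
    (hlim : Tendsto Q atTop (𝓝 Qτ)) (hQτ : 0 < Qτ) :
    Tendsto (deriv Q) atTop (𝓝 0) ∧ Tendsto (deriv (deriv Q)) atTop (𝓝 0) := by
  obtain ⟨m, rfl⟩ : ∃ m, d = m + 1 := ⟨d - 1, by omega⟩
  obtain ⟨hsmooth, hode, -⟩ := hQ
  have hcd : ∀ r, 0 < r → ContDiffAt ℝ 3 Q r := fun r hr =>
    hsmooth.contDiffAt (Ici_mem_nhds hr)
  have hcd' : ∀ r, 0 < r → ContDiffAt ℝ 2 (deriv Q) r := fun r hr =>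
    ((hcd r hr).fderiv_right (by norm_num)).clm_apply contDiffAt_const
  have hcd'' : ∀ r, 0 < r → ContDiffAt ℝ 1 (deriv (deriv Q)) r := fun r hr =>
    ((hcd' r hr).fderiv_right (by norm_num)).clm_apply contDiffAt_const
  have hD : ∀ r, 0 < r → HasDerivAt Q (deriv Q r) r := fun r hr =>
    ((hcd r hr).differentiableAt (by norm_num)).hasDerivAt
  have hD' : ∀ r, 0 < r → HasDerivAt (deriv Q) (deriv (deriv Q) r) r := fun r hr =>
    ((hcd' r hr).differentiableAt (by norm_num)).hasDerivAt
  have hm : (0:ℝ) < m + 1 := by positivity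
  set w : ℝ → ℝ := fun r => deriv (deriv Q) r + m * (deriv Q r / r) with hw
  set H : ℝ → ℝ := fun r => Q r ^ n * w r - Q r + Q r ^ n / c with hH
  have hHderiv : ∀ r, 0 < r →
      HasDerivAt H (m * n * Q r ^ (n - 1) * deriv Q r ^ 2 / r) r := by
    intro r hr
    simpa [hH, hw] using (hode r hr).hasDerivAt_flux hr (hpos r hr) (hD r hr).differentiableAt
      (hD' r hr).differentiableAt ((hcd'' r hr).differentiableAt (by norm_num))
  have hHnonneg : ∀ r, 0 < r → 0 ≤ m * n * Q r ^ (n - 1) * deriv Q r ^ 2 / r := by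
    intro r hr
    have := hpos r hr
    have : 0 ≤ n := by linarith [hn.1]
    positivity
  have hpow : Tendsto (fun r => Q r ^ n) atTop (𝓝 (Qτ ^ n)) :=
    hlim.rpow_const (Or.inl hQτ.ne')
  have hpowτ : 0 < Qτ ^ n := Real.rpow_pos_of_pos hQτ n
  have hrest : Tendsto (fun r => Q r - Q r ^ n / c) atTop (𝓝 (Qτ - Qτ ^ n / c)) :=
    hlim.sub (hpow.div_const c)
  have hweq : (fun r => (H r + (Q r - Q r ^ n / c)) * (Q r ^ n)⁻¹) =ᶠ[atTop] w := by
    filter_upwards [eventually_gt_atTop 0] with r hr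
    have := (Real.rpow_pos_of_pos (hpos r hr) n).ne'
    simp only [hH]
    field_simp
    ring
  have hpos_absurd : ∀ k : ℝ, 0 < k → ¬ ∀ᶠ r in atTop, k ≤ w r := by
    intro k hk hev
    obtain ⟨r, hr, hr0⟩ := ((eventually_linear_le_of_le_radial (k' := k / 2) hD' hev
      (by linarith)).and (eventually_gt_atTop 0)).exists
    have : 0 < k / 2 / (m + 1) * r := by positivity
    linarith [hdec r hr0]
  have hneg_absurd : ∀ k : ℝ, k < 0 → ¬ ∀ᶠ r in atTop, w r ≤ k := by
    intro k hk hev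
    have hlin := eventually_le_linear_of_radial_le (k' := k / 2) hD' hev (by linarith)
    have hδ : 0 < -(k / 2 / (m + 1)) := by
      rw [neg_pos]; exact div_neg_of_neg_of_pos (by linarith) hm
    refine not_tendsto_nhds_of_deriv_le_neg hδ hD ?_ hlim
    filter_upwards [hlin, eventually_ge_atTop 1] with r hr hr1
    nlinarith
  have hw0 : Tendsto w atTop (𝓝 0) := by
    rcases tendsto_atTop_or_nhds_of_deriv_nonneg hHderiv hHnonneg with hT | ⟨l, hl⟩
    · have hwT : Tendsto w atTop atTop :=
        ((hT.atTop_add hrest).atTop_mul_pos (inv_pos.2 hpowτ) (hpow.inv₀ hpowτ.ne')).congr' hweq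
      exact absurd (hwT.eventually_ge_atTop 1) (hpos_absurd 1 one_pos)
    · have hwl := ((hl.add hrest).mul (hpow.inv₀ hpowτ.ne')).congr' hweq
      generalize (l + (Qτ - Qτ ^ n / c)) * (Qτ ^ n)⁻¹ = L at hwl
      rcases lt_trichotomy L 0 with hL | rfl | hL
      · exact absurd (hwl.eventually_le_const (by linarith : L < L / 2))
          (hneg_absurd _ (by linarith))
      · exact hwl
      · exact absurd (hwl.eventually_const_le (by linarith : L / 2 < L))
          (hpos_absurd _ (by linarith))
  have hquot := tendsto_div_self_of_radial_tendsto_zero hD' hw0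
  have hsecond : Tendsto (deriv (deriv Q)) atTop (𝓝 0) := by
    simpa [hw] using hw0.sub (hquot.const_mul (m:ℝ))
  exact ⟨tendsto_deriv_zero_of_tendsto_of_second_deriv hD hD' hlim hsecond, hsecond⟩
end
end

section
/- Let d ∈ ℕ with d ≥ 1, n ∈ [2,3], c ∈ [1.55, n), μ < 0, and let Q ∈ C³([0,∞)) be a solution of the IVP with Q(r) > 0 and Q_r(r) < 0 for all r ∈ (0,∞), such that Q_τ := lim_{r→∞} Q(r) exists and satisfies 0 < Q_τ < (c/n)^{1/(n−1)}. Then there exist constants M > 0 and k > 0 such that |Q(r) − Q_τ| ≤ M e^{−kr} for all r > 0. -/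
open Set Filter Topology intervalIntegral Real

noncomputable section

lemma antitoneOn_Ici_of_hasDerivAt_nonpos {f f' : ℝ → ℝ} {R : ℝ}
    (hf : ∀ r, R ≤ r → HasDerivAt f (f' r) r) (hf' : ∀ r, R ≤ r → f' r ≤ 0) :
    AntitoneOn f (Ici R) := by
  refine antitoneOn_of_deriv_nonpos (convex_Ici R)
    (fun r hr => (hf r hr).continuousAt.continuousWithinAt) ?_ ?_
  · intro r hr
    rw [interior_Ici] at hr
    exact (hf r (le_of_lt hr)).differentiableAt.differentiableWithinAt
  · intro r hr
    rw [interior_Ici] at hr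
    rw [(hf r (le_of_lt hr)).deriv]
    exact hf' r (le_of_lt hr)

/-- A one-sided Riccati inequality bounds the slope of a bounded decreasing function. -/
lemma exists_neg_deriv_le_of_riccati {Q v w : ℝ → ℝ} {C K : ℝ} (hC : 0 ≤ C) (hK : 0 ≤ K)
    (hQ : ∀ r, 1 ≤ r → HasDerivAt Q (v r) r) (hv : ∀ r, 1 ≤ r → HasDerivAt v (w r) r)
    (hQ0 : ∀ r, 1 ≤ r → 0 ≤ Q r) (hQ1 : ∀ r, 1 ≤ r → Q r ≤ 1)
    (hneg : ∀ r, 1 ≤ r → v r < 0)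
    (hw : ∀ r, 1 ≤ r → -C - K * v r ^ 2 ≤ w r) :
    ∃ B, 0 < B ∧ ∀ r, 2 ≤ r → -v r ≤ B := by
  have hanti : AntitoneOn (fun r => Real.log (1 - v r) - C * r + K * Q r) (Ici 1) := by
    refine antitoneOn_Ici_of_hasDerivAt_nonpos
      (f' := fun r => (0 - w r) / (1 - v r) - C * 1 + K * v r) ?_ ?_
    · intro r hr
      have h1 : 1 - v r ≠ 0 := by linarith [hneg r hr]
      exact (((((hasDerivAt_const r (1 : ℝ)).sub (hv r hr)).log h1).sub
        ((hasDerivAt_id r).const_mul C)).add ((hQ r hr).const_mul K))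
    · intro r hr
      have hn := hneg r hr
      have h1 : 0 < 1 - v r := by linarith
      have h2 : (0 - w r) / (1 - v r) ≤ C - K * v r := by
        rw [div_le_iff₀ h1]
        nlinarith [hw r hr, mul_nonneg hC (neg_nonneg.2 hn.le), mul_nonneg hK (neg_nonneg.2 hn.le)]
      linarith
  refine ⟨Real.exp (Real.log 2 + C + K), Real.exp_pos _, fun r hr => ?_⟩
  obtain ⟨s, ⟨hs1, hs2⟩, hs⟩ := exists_hasDerivAt_eq_slope Q v (a := r - 1) (b := r)
    (by linarith)
    (fun x hx => (hQ x (by linarith [hx.1])).continuousAt.continuousWithinAt)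
    (fun x hx => hQ x (by linarith [hx.1]))
  have hvs : 1 - v s ≤ 2 := by
    rw [hs, sub_sub_cancel, div_one]
    linarith [hQ0 r (by linarith), hQ1 (r - 1) (by linarith)]
  have hs0 := hneg s (by linarith)
  have hr0 := hneg r (by linarith)
  have hlog : Real.log (1 - v s) ≤ Real.log 2 := Real.log_le_log (by linarith) hvs
  have hmono := hanti (show s ∈ Ici 1 by simp only [mem_Ici]; linarith)
    (show r ∈ Ici 1 by simp only [mem_Ici]; linarith) hs2.le
  simp only at hmono
  have hCs : C * (r - s) ≤ C * 1 := mul_le_mul_of_nonneg_left (by linarith) hC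
  have hKs : K * (Q s - Q r) ≤ K * 1 := mul_le_mul_of_nonneg_left
    (by linarith [hQ0 r (by linarith), hQ1 s (by linarith)]) hK
  have : 1 - v r ≤ Real.exp (Real.log 2 + C + K) := by
    rw [← Real.log_le_iff_le_exp (by linarith)]
    linarith
  linarith

/-- A positive decreasing solution of a second-order inequality, tending to zero decays exponentially. -/
lemma le_mul_exp_of_sq_mul_le_deriv2 {P v w : ℝ → ℝ} {R k : ℝ} (hk : 0 < k)
    (hP : ∀ r, R ≤ r → HasDerivAt P (v r) r) (hv : ∀ r, R ≤ r → HasDerivAt v (w r) r)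
    (hpos : ∀ r, R ≤ r → 0 ≤ P r) (hneg : ∀ r, R ≤ r → v r < 0)
    (hw : ∀ r, R ≤ r → k ^ 2 * P r ≤ w r) (hlim : Tendsto P atTop (𝓝 0)) :
    ∀ r, R ≤ r → P r ≤ P R * Real.exp (k * R) * Real.exp (-k * r) := by
  have hE : AntitoneOn (fun r => v r ^ 2 - k ^ 2 * P r ^ 2) (Ici R) := by
    refine antitoneOn_Ici_of_hasDerivAt_nonpos
      (f' := fun r => 2 * v r * w r - k ^ 2 * (2 * P r * v r)) ?_ ?_
    · intro r hr
      exact (((hv r hr).pow 2).sub (((hP r hr).pow 2).const_mul (k ^ 2))).congr_deriv (by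
        push_cast
        ring)
    · intro r hr
      nlinarith [mul_nonneg (neg_nonneg.2 (hneg r hr).le) (sub_nonneg.2 (hw r hr))]
  have hEpos : ∀ r, R ≤ r → k ^ 2 * P r ^ 2 ≤ v r ^ 2 := by
    intro r hr
    by_contra! h
    have hlim2 : Tendsto (fun s => k ^ 2 * P s ^ 2) atTop (𝓝 0) := by
      simpa using (hlim.pow 2).const_mul (k ^ 2)
    obtain ⟨s, hs, hsr⟩ := ((hlim2.eventually_lt_const (sub_pos.2 h)).and
      (eventually_ge_atTop r)).exists
    have := hE hr (hr.trans hsr : R ≤ s) hsr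
    simp only at this
    nlinarith [sq_nonneg (v s)]
  have hvP : ∀ r, R ≤ r → v r + k * P r ≤ 0 := by
    intro r hr
    have h1 : (k * P r) ^ 2 ≤ (-v r) ^ 2 := by nlinarith [hEpos r hr]
    have h2 := (sq_le_sq₀ (mul_nonneg hk.le (hpos r hr)) (neg_nonneg.2 (hneg r hr).le)).1 h1
    linarith
  have hF : AntitoneOn (fun r => P r * Real.exp (k * r)) (Ici R) := by
    refine antitoneOn_Ici_of_hasDerivAt_nonpos
      (f' := fun r => v r * Real.exp (k * r) + P r * (Real.exp (k * r) * (k * 1))) ?_ ?_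
    · intro r hr
      exact (hP r hr).mul (((hasDerivAt_id r).const_mul k).exp)
    · intro r hr
      have : v r * Real.exp (k * r) + P r * (Real.exp (k * r) * (k * 1))
          = (v r + k * P r) * Real.exp (k * r) := by ring
      simp only [this]
      exact mul_nonpos_of_nonpos_of_nonneg (hvP r hr) (Real.exp_pos _).le
  intro r hr
  have h := hF (self_mem_Ici : R ∈ Ici R) hr hr
  simp only at h
  calc P r = P r * Real.exp (k * r) * Real.exp (-k * r) := by
        rw [mul_assoc, ← Real.exp_add]; simp
    _ ≤ _ := mul_le_mul_of_nonneg_right h (Real.exp_pos _).le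

/-- A function whose derivative is eventually below a negative constant is unbounded below. -/
lemma exists_lt_of_eventually_deriv_le {v w : ℝ → ℝ} {R δ : ℝ} (hδ : 0 < δ) (B : ℝ)
    (hv : ∀ r, R ≤ r → HasDerivAt v (w r) r) (hw : ∀ r, R ≤ r → w r ≤ -δ) :
    ∃ r, R ≤ r ∧ v r < B := by
  have hanti : AntitoneOn (fun r => v r + δ * r) (Ici R) := by
    refine antitoneOn_Ici_of_hasDerivAt_nonpos (f' := fun r => w r + δ * 1) ?_ ?_
    · intro r hr
      exact (hv r hr).add ((hasDerivAt_id r).const_mul δ)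
    · intro r hr
      linarith [hw r hr]
  obtain ⟨r, h1, hr⟩ := (((tendsto_id.const_mul_atTop hδ).eventually_gt_atTop
    (v R + δ * R - B)).and (eventually_ge_atTop R)).exists
  have h2 := hanti (self_mem_Ici : R ∈ Ici R) hr hr
  simp only [id] at h1 h2
  exact ⟨r, hr, by linarith⟩

/-- The expanded form of the magma equation along `(Q, v, w)` where `v` and `w` are the first
and second derivatives of `Q`. -/
def MagmaSystem (D n c : ℝ) (Q v w : ℝ → ℝ) : Prop :=
  ∀ r, 0 < r → HasDerivAt Q (v r) r ∧ HasDerivAt v (w r) r ∧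
    HasDerivAt (fun s => w s + D * (v s / s))
      (v r * (1 - n / c * Q r ^ (n - 1)) / Q r ^ n - n * v r * w r / Q r) r

lemma isIVPSolution.magmaSystem {d n c μ : ℝ} {Q : ℝ → ℝ} (hQ : isIVPSolution d n c μ Q)
    (hpos : ∀ r : ℝ, 0 < r → 0 < Q r) :
    MagmaSystem (d - 1) n c Q (deriv Q) (deriv (deriv Q)) := by
  obtain ⟨hcd, hode, -⟩ := hQ
  intro r hr
  have h3 : ContDiffOn ℝ 3 Q (Ioi 0) := hcd.mono Ioi_subset_Ici_self
  have h2 : ContDiffOn ℝ 2 (deriv Q) (Ioi 0) := h3.deriv_of_isOpen isOpen_Ioi (by norm_num)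
  have h1 : ContDiffOn ℝ 1 (deriv (deriv Q)) (Ioi 0) :=
    h2.deriv_of_isOpen isOpen_Ioi (by norm_num)
  have hnhds : Ioi (0 : ℝ) ∈ 𝓝 r := Ioi_mem_nhds hr
  have hQ' := ((h3.contDiffAt hnhds).differentiableAt (by norm_num)).hasDerivAt
  have hv' := ((h2.contDiffAt hnhds).differentiableAt (by norm_num)).hasDerivAt
  have hw' := ((h1.contDiffAt hnhds).differentiableAt (by norm_num)).hasDerivAt
  have hq := hpos r hr
  have hpow := hQ'.rpow_const (p := n) (Or.inl hq.ne')
  have hdiv := hv'.div (hasDerivAt_id r) hr.ne'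
  refine ⟨hQ', hv', ?_⟩
  have hL := hw'.add (hdiv.const_mul (d - 1))
  refine hL.congr_deriv ?_
  have e := hode r hr
  unfold magmaODE at e
  have e1 : deriv (fun s => Q s ^ n * deriv (deriv Q) s) r = _ := (hpow.mul hw').deriv
  have e2 : deriv (fun s => deriv Q s / s) r = _ := hdiv.deriv
  rw [hpow.deriv, e1, e2] at e
  have hrp : Q r ^ n = Q r ^ (n - 1) * Q r := by
    rw [← Real.rpow_add_one hq.ne', sub_add_cancel]
  have hp : 0 < Q r ^ (n - 1) := Real.rpow_pos_of_pos hq _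
  rw [hrp] at e ⊢
  generalize Q r ^ (n - 1) = p at *
  generalize (deriv (deriv Q) r * id r - deriv Q r * 1) / id r ^ 2 = x at *
  rw [div_sub_div _ _ (by positivity) hq.ne', eq_div_iff (by positivity)]
  linear_combination Q r * e

lemma MagmaSystem.exists_riccati {D n c Qτ : ℝ} {Q v w : ℝ → ℝ} (h : MagmaSystem D n c Q v w)
    (hD : 0 ≤ D) (hn : 0 ≤ n) (hc : 0 < c) (hQτ : 0 < Qτ)
    (hge : ∀ r, 0 < r → Qτ ≤ Q r) (hQ1 : ∀ r, 0 < r → Q r ≤ 1)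
    (hneg : ∀ r, 0 < r → v r < 0) :
    ∃ C K, 0 ≤ C ∧ 0 ≤ K ∧ ∀ r, 1 ≤ r → -C - K * v r ^ 2 ≤ w r := by
  set C₁ := 1 / Qτ ^ n
  have hC₁pos : 0 < C₁ := by positivity
  set H : ℝ → ℝ := fun r => w r + D * (v r / r) + n / 2 * (v r ^ 2 / Q r)
  have hanti : AntitoneOn (fun r => C₁ * Q r - H r) (Ici 1) := by
    refine antitoneOn_Ici_of_hasDerivAt_nonpos (f' := fun r => C₁ * v r -
      ((v r * (1 - n / c * Q r ^ (n - 1)) / Q r ^ n - n * v r * w r / Q r) +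
        n / 2 * (((2 : ℕ) * v r ^ (2 - 1) * w r * Q r - v r ^ 2 * v r) / Q r ^ 2))) ?_ ?_
    · intro r hr
      obtain ⟨h1, h2, h3⟩ := h r (by linarith)
      have hq : 0 < Q r := hQτ.trans_le (hge r (by linarith))
      exact (h1.const_mul C₁).sub (h3.add (((h2.pow 2).div h1 hq.ne').const_mul (n / 2)))
    · intro r hr
      have hr0 : 0 < r := by linarith
      have hq : 0 < Q r := hQτ.trans_le (hge r hr0)
      have hv := hneg r hr0
      have hpn : 0 < Q r ^ n := Real.rpow_pos_of_pos hq _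
      have hA : (1 - n / c * Q r ^ (n - 1)) / Q r ^ n ≤ C₁ := by
        refine div_le_div₀ zero_le_one ?_ (by positivity)
          (Real.rpow_le_rpow hQτ.le (hge r hr0) hn)
        have : 0 ≤ n / c * Q r ^ (n - 1) := by positivity
        linarith
      have h1 : 0 ≤ (-v r) * (C₁ - (1 - n / c * Q r ^ (n - 1)) / Q r ^ n) :=
        mul_nonneg (by linarith) (by linarith)
      have h2 : 0 ≤ n / 2 * ((-v r) ^ 3 / Q r ^ 2) := by
        have : 0 < -v r := by linarith
        positivity
      have h3 : C₁ * v r -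
        ((v r * (1 - n / c * Q r ^ (n - 1)) / Q r ^ n - n * v r * w r / Q r) +
          n / 2 * (((2 : ℕ) * v r ^ (2 - 1) * w r * Q r - v r ^ 2 * v r) / Q r ^ 2)) =
        -((-v r) * (C₁ - (1 - n / c * Q r ^ (n - 1)) / Q r ^ n)) -
          n / 2 * ((-v r) ^ 3 / Q r ^ 2) := by
        field_simp
        push_cast
        ring
      simp only [h3]
      linarith
  refine ⟨|H 1| + C₁, n / 2 / Qτ, by positivity, by positivity, fun r hr => ?_⟩
  have hr0 : 0 < r := by linarith
  have hq : 0 < Q r := hQτ.trans_le (hge r hr0)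
  have h1 := hanti (self_mem_Ici : (1 : ℝ) ∈ Ici 1) hr hr
  simp only at h1
  have h2 : C₁ * Q 1 ≤ C₁ * 1 := mul_le_mul_of_nonneg_left (hQ1 1 one_pos) hC₁pos.le
  have h3 : 0 < C₁ * Q r := by positivity
  have h4 : D * (v r / r) ≤ 0 :=
    mul_nonpos_of_nonneg_of_nonpos hD (div_nonpos_of_nonpos_of_nonneg (hneg r hr0).le hr0.le)
  have h5 : n / 2 * (v r ^ 2 / Q r) ≤ n / 2 / Qτ * v r ^ 2 := by
    rw [div_mul_eq_mul_div (n / 2), mul_div_assoc]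
    have := hge r hr0
    gcongr
  have h6 : H r = w r + D * (v r / r) + n / 2 * (v r ^ 2 / Q r) := rfl
  linarith [neg_abs_le (H 1)]

/-- Eventually the second derivative dominates a positive multiple of `Q - Qτ`. -/
lemma MagmaSystem.exists_sq_mul_le {D n c Qτ B : ℝ} {Q v w : ℝ → ℝ}
    (h : MagmaSystem D n c Q v w)
    (hD : 0 ≤ D) (hn : 1 ≤ n) (hc : 0 < c) (hQτ : 0 < Qτ)
    (hge : ∀ r, 0 < r → Qτ ≤ Q r) (hQ1 : ∀ r, 0 < r → Q r ≤ 1)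
    (hneg : ∀ r, 0 < r → v r < 0) (hB : ∀ r, 2 ≤ r → -v r ≤ B)
    (hlim : Tendsto Q atTop (𝓝 Qτ)) (ha : n / c * Qτ ^ (n - 1) < 1) :
    ∃ R k, 0 < R ∧ 0 < k ∧ ∀ r, R ≤ r → k ^ 2 * (Q r - Qτ) ≤ w r := by
  set a := 1 - n / c * Qτ ^ (n - 1)
  have hapos : 0 < a := by linarith
  have hinv (κ : ℝ) : Tendsto (fun r : ℝ => κ / r) atTop (𝓝 0) :=
    tendsto_const_nhds.div_atTop tendsto_id
  have hAlim : Tendsto (fun r => 1 - n / c * Q r ^ (n - 1)) atTop (𝓝 a) :=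
    ((hlim.rpow_const (Or.inl hQτ.ne')).const_mul _).const_sub 1
  obtain ⟨R, hR⟩ := eventually_atTop.1 ((eventually_ge_atTop (2 : ℝ)).and
    ((hAlim.eventually_const_lt (show 3 * a / 4 < a by linarith)).and
      ((hinv (D * n * B)).eventually_lt_const (show 0 < a / 4 by linarith))))
  have hR2 : 2 ≤ R := (hR R le_rfl).1
  have hR0 : ∀ r, R ≤ r → 0 < r := fun r hr => by linarith
  have hq : ∀ r, R ≤ r → 0 < Q r := fun r hr => hQτ.trans_le (hge r (hR0 r hr))
  set G : ℝ → ℝ := fun r => Q r ^ n * (w r + D * (v r / r))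
  have hanti : AntitoneOn (fun r => G r - a / 2 * Q r) (Ici R) := by
    refine antitoneOn_Ici_of_hasDerivAt_nonpos (f' := fun r =>
      (v r * n * Q r ^ (n - 1) * (w r + D * (v r / r)) +
        Q r ^ n * (v r * (1 - n / c * Q r ^ (n - 1)) / Q r ^ n - n * v r * w r / Q r)) -
        a / 2 * v r) ?_ ?_
    · intro r hr
      obtain ⟨h1, h2, h3⟩ := h r (hR0 r hr)
      exact ((h1.rpow_const (Or.inl (hq r hr).ne')).mul h3).sub (h1.const_mul _)
    · intro r hr
      have hr0 := hR0 r hr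
      have hqr := hq r hr
      have hp : 0 < Q r ^ (n - 1) := Real.rpow_pos_of_pos hqr _
      have hp1 : Q r ^ (n - 1) ≤ 1 := Real.rpow_le_one hqr.le (hQ1 r hr0) (by linarith)
      have hrp : Q r ^ n = Q r ^ (n - 1) * Q r := by
        rw [← Real.rpow_add_one hqr.ne', sub_add_cancel]
      have hv := hneg r hr0
      obtain ⟨-, hA, hDB⟩ := hR r hr
      have hsmall : D * n * Q r ^ (n - 1) * (-v r) / r ≤ D * n * B / r := by
        refine div_le_div_of_nonneg_right ?_ hr0.le
        calc D * n * Q r ^ (n - 1) * (-v r) ≤ D * n * 1 * (-v r) := by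
              gcongr
              linarith
          _ ≤ D * n * B := by
              rw [mul_one]
              exact mul_le_mul_of_nonneg_left (hB r (by linarith)) (by positivity)
      have h3 : (v r * n * Q r ^ (n - 1) * (w r + D * (v r / r)) +
          Q r ^ n * (v r * (1 - n / c * Q r ^ (n - 1)) / Q r ^ n - n * v r * w r / Q r)) -
          a / 2 * v r = -((-v r) * ((1 - n / c * Q r ^ (n - 1)) -
            D * n * Q r ^ (n - 1) * (-v r) / r - a / 2)) := by
        rw [hrp]
        field_simp
        ring
      simp only [h3]
      exact neg_nonpos.2 (mul_nonneg (by linarith) (by linarith))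
  have hGP : ∀ r, R ≤ r → a / 2 * (Q r - Qτ) ≤ G r := by
    intro r hr
    by_contra! hlt
    obtain ⟨δ, hδ⟩ : ∃ δ, δ = (a / 2 * (Q r - Qτ) - G r) / 2 := ⟨_, rfl⟩
    have hδpos : 0 < δ := by linarith
    have hlim' : Tendsto (fun s => a / 2 * (Q s - Qτ)) atTop (𝓝 0) := by
      simpa using (hlim.sub_const Qτ).const_mul (a / 2)
    obtain ⟨S, hS⟩ := eventually_atTop.1 ((eventually_ge_atTop r).and
      ((hlim'.eventually_lt_const hδpos).and
        ((hinv (D * B)).eventually_lt_const (show 0 < δ / 2 by linarith))))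
    have hwS : ∀ s, S ≤ s → w s ≤ -(δ / 2) := by
      intro s hs
      obtain ⟨hrs, h1, h2⟩ := hS s hs
      have hRs := hr.trans hrs
      have hs0 := hR0 s hRs
      have h3 := hanti hr hRs hrs
      simp only at h3
      have hGs : Q s ^ n * (w s + D * (v s / s)) ≤ -δ := by
        change G s ≤ -δ
        linarith
      have hpn : 0 < Q s ^ n := Real.rpow_pos_of_pos (hq s hRs) _
      have hpn1 : Q s ^ n ≤ 1 := Real.rpow_le_one (hq s hRs).le (hQ1 s hs0) (by linarith)
      have h4 : w s + D * (v s / s) ≤ -δ := by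
        by_contra! h5
        nlinarith
      have h6 : D * (-v s) / s ≤ D * B / s :=
        div_le_div_of_nonneg_right (mul_le_mul_of_nonneg_left (hB s (by linarith)) hD) hs0.le
      have h7 : D * (-v s) / s = -(D * (v s / s)) := by ring
      linarith
    have hSr := (hS S le_rfl).1
    obtain ⟨s, hs, hvs⟩ := exists_lt_of_eventually_deriv_le (half_pos hδpos) (-B)
      (fun s hs => (h s (hR0 s (by linarith))).2.1) hwS
    linarith [hB s (by linarith)]
  refine ⟨R, √(a / 2), by linarith, Real.sqrt_pos.2 (by linarith), fun r hr => ?_⟩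
  rw [Real.sq_sqrt (by linarith)]
  have hr0 := hR0 r hr
  have hpn : 0 < Q r ^ n := Real.rpow_pos_of_pos (hq r hr) _
  have hpn1 : Q r ^ n ≤ 1 := Real.rpow_le_one (hq r hr).le (hQ1 r hr0) (by linarith)
  have h1 : 0 ≤ a / 2 * (Q r - Qτ) := mul_nonneg (by linarith) (sub_nonneg.2 (hge r hr0))
  have h2 : a / 2 * (Q r - Qτ) ≤ Q r ^ n * (w r + D * (v r / r)) := hGP r hr
  have h3 : D * (v r / r) ≤ 0 :=
    mul_nonpos_of_nonneg_of_nonpos hD (div_nonpos_of_nonpos_of_nonneg (hneg r hr0).le hr0.le)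
  have h4 : 0 ≤ w r + D * (v r / r) := nonneg_of_mul_nonneg_right (h1.trans h2) hpn
  nlinarith

/-- Sufficient condition for exponential convergence of the profile to its limit
(Proposition on exponential decay). -/
theorem magma_exponential_convergence
    (d : ℕ) (hd : 1 ≤ d) (n c μ Qτ : ℝ)
    (hn : n ∈ Icc (2:ℝ) 3) (hc : c ∈ Ico (1.55:ℝ) n) (hμ : μ < 0)
    (Q : ℝ → ℝ) (hQ : isIVPSolution (d:ℝ) n c μ Q)
    (hpos : ∀ r : ℝ, 0 < r → 0 < Q r) (hdec : ∀ r : ℝ, 0 < r → deriv Q r < 0)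
    (hlim : Tendsto Q atTop (𝓝 Qτ))
    (hQτ : 0 < Qτ) (hQτub : Qτ < (c / n) ^ (1 / (n - 1))) :
    ∃ M : ℝ, 0 < M ∧ ∃ k : ℝ, 0 < k ∧
      ∀ r : ℝ, 0 < r → |Q r - Qτ| ≤ M * Real.exp (-k * r) := by
  obtain ⟨hn2, hn3⟩ := hn
  have hc0 : 0 < c := by
    have := hc.1
    norm_num at this
    linarith
  have hD : (0 : ℝ) ≤ (d : ℝ) - 1 := by
    have : (1 : ℝ) ≤ d := by exact_mod_cast hd
    linarith
  have hsys := hQ.magmaSystem hpos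
  have hanti : AntitoneOn Q (Ici 0) := by
    refine antitoneOn_of_deriv_nonpos (convex_Ici 0) hQ.1.continuousOn ?_ ?_
    · rw [interior_Ici]
      exact (hQ.1.mono Ioi_subset_Ici_self).differentiableOn (by norm_num)
    · rw [interior_Ici]
      exact fun r hr => (hdec r hr).le
  have hQ1 : ∀ r, 0 < r → Q r ≤ 1 := fun r hr =>
    hQ.2.2.1 ▸ hanti (self_mem_Ici : (0 : ℝ) ∈ Ici 0) hr.le hr.le
  have hge : ∀ r, 0 < r → Qτ ≤ Q r := fun r hr =>
    le_of_tendsto hlim (by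
      filter_upwards [eventually_ge_atTop r] with s hs
      exact hanti hr.le (hr.le.trans hs) hs)
  have ha : n / c * Qτ ^ (n - 1) < 1 := by
    have h1 := Real.rpow_lt_rpow hQτ.le hQτub (show 0 < n - 1 by linarith)
    rw [← Real.rpow_mul (by positivity), one_div_mul_cancel (by linarith), Real.rpow_one,
      lt_div_iff₀ (by linarith)] at h1
    rw [div_mul_eq_mul_div, div_lt_one hc0]
    linarith
  obtain ⟨C, K, hC, hK, hw⟩ := hsys.exists_riccati hD (by linarith) hc0 hQτ hge hQ1 hdec
  have hpos1 : ∀ r : ℝ, 1 ≤ r → 0 < r := fun r hr => by linarith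
  obtain ⟨B, -, hB⟩ := exists_neg_deriv_le_of_riccati hC hK
    (fun r hr => (hsys r (hpos1 r hr)).1) (fun r hr => (hsys r (hpos1 r hr)).2.1)
    (fun r hr => (hpos r (hpos1 r hr)).le) (fun r hr => hQ1 r (hpos1 r hr))
    (fun r hr => hdec r (hpos1 r hr)) hw
  obtain ⟨R, k, hR, hk, hwk⟩ := hsys.exists_sq_mul_le hD (by linarith) hc0 hQτ hge hQ1 hdec hB
    hlim ha
  have hdecay := le_mul_exp_of_sq_mul_le_deriv2 (P := fun r => Q r - Qτ) hk
    (fun r hr => ((hsys r (hR.trans_le hr)).1).sub_const Qτ)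
    (fun r hr => (hsys r (hR.trans_le hr)).2.1)
    (fun r hr => sub_nonneg.2 (hge r (hR.trans_le hr)))
    (fun r hr => hdec r (hR.trans_le hr)) hwk (by simpa using hlim.sub_const Qτ)
  refine ⟨Real.exp (k * R), Real.exp_pos _, k, hk, fun r hr => ?_⟩
  rw [abs_of_nonneg (sub_nonneg.2 (hge r hr))]
  rcases le_total R r with hRr | hrR
  · refine (hdecay r hRr).trans ?_
    gcongr
    exact mul_le_of_le_one_left (Real.exp_pos _).le (by linarith [hQ1 R hR])
  · rw [← Real.exp_add]
    have h1 : (1 : ℝ) ≤ Real.exp (k * R + -k * r) := Real.one_le_exp (by nlinarith)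
    linarith [hQ1 r hr]
end
end
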